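/- Assume r ∈ [0,1] is fixed, α is strictly increasing on (a,b), β ∈ BV_loc((a,b),ℝ), and θ_{1−r}(x) ≠ 0 and θ_r(x) ≠ 0 for all x ∈ (a,b). Then the following are equivalent: (i) for every nontrivial real-valued r-balanced solution u of −d(dy/dα) + y dβ = 0 on (a,b), the set Z_{(a,b)}(u) consists precisely of the points in (a,b) at which u changes sign; (ii) θ_r(x) > 0 and θ_{1−r}(x) > 0 for all x ∈ (a,b). -/

import Mathlib

open Set Filter Function MeasureTheory Topology

noncomputable section

/-- The open interval `(a,b) ⊆ ℝ` determined by extended-real endpoints `a`, `b`. -/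
def EI (a b : EReal) : Set ℝ := {x : ℝ | a < (x : EReal) ∧ (x : EReal) < b}

/-- The jump `Δ_{df}(x) = f⁺(x) - f⁻(x)` of a real-valued function. -/
def jump (f : ℝ → ℝ) (x : ℝ) : ℝ := rightLim f x - leftLim f x

/-- The jump `Δ_{df}(x) = f⁺(x) - f⁻(x)` of a complex-valued function. -/
def jumpC (f : ℝ → ℂ) (x : ℝ) : ℂ := rightLim f x - leftLim f x

/-- `θ_z(x) = 1 - z² Δ_{dα}(x) Δ_{dβ}(x)`. -/
def theta (α β : ℝ → ℝ) (z x : ℝ) : ℝ := 1 - z ^ 2 * jump α x * jump β x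

/-- `ω(x) = 1 - Δ_{dα}(x) Δ_{dβ}(x) / 4`. -/
def omegaFn (α β : ℝ → ℝ) (x : ℝ) : ℝ := 1 - jump α x * jump β x / 4

/-- A real-valued function is `r`-balanced on `I`: it is of locally bounded variation and
`f(x) = r f⁻(x) + (1-r) f⁺(x)` for all `x ∈ I`. -/
def RBalanced (r : ℝ) (I : Set ℝ) (f : ℝ → ℝ) : Prop :=
  LocallyBoundedVariationOn f I ∧
    ∀ x ∈ I, f x = r * leftLim f x + (1 - r) * rightLim f x

/-- A complex-valued function is `r`-balanced on `I`. -/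
def RBalancedC (r : ℂ) (I : Set ℝ) (f : ℝ → ℂ) : Prop :=
  LocallyBoundedVariationOn f I ∧
    ∀ x ∈ I, f x = r * leftLim f x + (1 - r) * rightLim f x

/-- `ν` coincides on `[c,d]` with the Lebesgue–Stieltjes measure `df` generated by `f`,
determined by `df((x,y]) = f⁺(y) - f⁺(x)`. -/
def SMRepresents (ν : SignedMeasure ℝ) (f : ℝ → ℝ) (c d : ℝ) : Prop :=
  ∀ x ∈ Icc c d, ∀ y ∈ Icc c d, x ≤ y → ν (Ioc x y) = rightLim f y - rightLim f x

/-- The integral of `h` against the signed measure `ν` over the set `E`. -/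
def sInt (ν : SignedMeasure ℝ) (h : ℝ → ℝ) (E : Set ℝ) : ℝ :=
  (∫ x in E, h x ∂ν.toJordanDecomposition.posPart) -
    (∫ x in E, h x ∂ν.toJordanDecomposition.negPart)

/-- The equality of (locally finite, real Borel) measures `dg = ∑ j, (h j) d(β j)` on the
interval `I`, expressed via localizations to compact subintervals of `I`. -/
def MeasureEqOn (I : Set ℝ) {ι : Type} [Fintype ι] (g : ℝ → ℝ) (h β : ι → ℝ → ℝ) : Prop :=
  ∀ c ∈ I, ∀ d ∈ I, c < d →
    ∃ (νg : SignedMeasure ℝ) (ν : ι → SignedMeasure ℝ),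
      SMRepresents νg g c d ∧ (∀ j, SMRepresents (ν j) (β j) c d) ∧
      ∀ E : Set ℝ, E ⊆ Ioc c d → MeasurableSet E → νg E = ∑ j, sInt (ν j) (h j) E

/-- The equality of complex measures `dg = ∑ j, (h j) d(β j)` on `I`, encoded via real and
imaginary parts. -/
def MeasureEqOnC (I : Set ℝ) {ι : Type} [Fintype ι] (g : ℝ → ℂ) (h β : ι → ℝ → ℂ) : Prop :=
  MeasureEqOn I (fun x => (g x).re)
    (Sum.elim (fun j x => (h j x).re) (fun j x => -(h j x).im))
    (Sum.elim (fun j x => (β j x).re) (fun j x => (β j x).im)) ∧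
  MeasureEqOn I (fun x => (g x).im)
    (Sum.elim (fun j x => (h j x).im) (fun j x => (h j x).re))
    (Sum.elim (fun j x => (β j x).re) (fun j x => (β j x).im))

/-- The support of `dα` is all of `I`: no open subinterval of `I` is `dα`-null, i.e. on no
open subinterval of `I` do all one-sided limits of `α` coincide with a single constant. -/
def SuppFull (I : Set ℝ) (α : ℝ → ℂ) : Prop :=
  ∀ x ∈ I, ∀ ε > (0 : ℝ), Icc (x - ε) (x + ε) ⊆ I →
    ¬ (∀ p ∈ Ioo (x - ε) (x + ε), ∀ q ∈ Ioo (x - ε) (x + ε),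
        rightLim α p = rightLim α q ∧ leftLim α p = rightLim α q)

/-- `u`, together with the representative `w` of `du/dα`, is an `r`-balanced solution of the
homogeneous equation `-d(du/dα) + u dβ = 0` on `I`: `u` and `w` are `r`-balanced,
`du = w dα` (so `du ≪ dα` with `du/dα = w`), and `dw = u dβ`. -/
def IsHomSol (I : Set ℝ) (r : ℝ) (α β u w : ℝ → ℝ) : Prop :=
  RBalanced r I u ∧ RBalanced r I w ∧
  MeasureEqOn I u (fun _ : Fin 1 => w) (fun _ => α) ∧
  MeasureEqOn I w (fun _ : Fin 1 => u) (fun _ => β)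

/-- `u`, together with the representative `w` of `du/dα`, is an `r`-balanced solution of
`-d(du/dα) + u dβ = dη` on `I` (complex-valued coefficients): `dw = u dβ - dη`. -/
def IsSolC (I : Set ℝ) (r : ℂ) (α β η u w : ℝ → ℂ) : Prop :=
  RBalancedC r I u ∧ RBalancedC r I w ∧
  MeasureEqOnC I u (fun _ : Fin 1 => w) (fun _ => α) ∧
  MeasureEqOnC I w ![u, fun _ => (-1 : ℂ)] ![β, η]

/-- `y` solves the linear system `dy = dφ · y + dψ` on `I`, componentwise:
`d(y i) = ∑ j, (y j) d(φ i j) + dψ i`. -/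
def IsSysSolC (I : Set ℝ) (n : ℕ) (φ : ℝ → Matrix (Fin n) (Fin n) ℂ)
    (ψ : ℝ → Fin n → ℂ) (y : ℝ → Fin n → ℂ) : Prop :=
  ∀ i : Fin n,
    MeasureEqOnC I (fun x => y x i)
      (Sum.elim (fun j : Fin n => fun x => y x j) (fun _ : Unit => fun _ => (1 : ℂ)))
      (Sum.elim (fun j : Fin n => fun x => φ x i j) (fun _ : Unit => fun x => ψ x i))

/-- `Z_I(f) = {x ∈ I : f⁻(x) f⁺(x) ≤ 0}`, the set of sign-changing points of `f` in `I`. -/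
def ZSet (f : ℝ → ℝ) (I : Set ℝ) : Set ℝ := {x ∈ I | leftLim f x * rightLim f x ≤ 0}

/-- `u` changes sign at `s ∈ I`. -/
def ChangesSignAt (I : Set ℝ) (u : ℝ → ℝ) (s : ℝ) : Prop :=
  ∃ δ > (0 : ℝ), Ioo (s - δ) (s + δ) ⊆ I ∧
    (((∀ x ∈ Ioo (s - δ) s, leftLim u x < 0) ∧ ∀ x ∈ Ioo s (s + δ), 0 < rightLim u x) ∨
     ((∀ x ∈ Ioo (s - δ) s, 0 < leftLim u x) ∧ ∀ x ∈ Ioo s (s + δ), rightLim u x < 0))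

/-- `u` changes sign in `J` (a subinterval of `I`). -/
def ChangesSignIn (I : Set ℝ) (u : ℝ → ℝ) (J : Set ℝ) : Prop :=
  ∃ s ∈ J, ChangesSignAt I u s

/-- `u` and `v` are linearly dependent on `I`. -/
def LinDepOn (I : Set ℝ) (u v : ℝ → ℝ) : Prop :=
  ∃ c₁ c₂ : ℝ, ¬(c₁ = 0 ∧ c₂ = 0) ∧ ∀ x ∈ I, c₁ * u x + c₂ * v x = 0

/-- The Lebesgue–Stieltjes measure `dg` is nonnegative on (Borel subsets of) `S`, expressed by
nonnegativity on all subintervals of `S` of each of the four kinds. -/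
def PosMeasureOn (g : ℝ → ℝ) (S : Set ℝ) : Prop :=
  (∀ x y : ℝ, x ≤ y → Icc x y ⊆ S → 0 ≤ rightLim g y - leftLim g x) ∧
  (∀ x y : ℝ, x ≤ y → Ico x y ⊆ S → 0 ≤ leftLim g y - leftLim g x) ∧
  (∀ x y : ℝ, x ≤ y → Ioc x y ⊆ S → 0 ≤ rightLim g y - rightLim g x) ∧
  (∀ x y : ℝ, x < y → Ioo x y ⊆ S → 0 ≤ leftLim g y - rightLim g x)

/-- Measurable and bounded functions. -/
def BddMeas {V : Type*} [NormedAddCommGroup V] [MeasurableSpace V] (f : ℝ → V) : Prop :=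
  Measurable f ∧ ∃ C, ∀ x, ‖f x‖ ≤ C

/-- The open interval with endpoints `s` and `x`, in either order. -/
def between (s x : ℝ) : Set ℝ := Ioo (min s x) (max s x)

lemma between_of_lt {s x : ℝ} (h : s < x) : between s x = Ioo s x := by
  simp [between, h.le]

lemma between_of_gt {s x : ℝ} (h : x < s) : between s x = Ioo x s := by
  simp [between, h.le]

lemma between_self (s : ℝ) : between s s = ∅ := by simp [between]

lemma measurableSet_between (s x : ℝ) : MeasurableSet (between s x) := measurableSet_Ioo

lemma measurable_measureReal_between (μ : Measure ℝ) [IsFiniteMeasure μ] (s : ℝ) :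
    Measurable fun x => μ.real (between s x) := by
  have h₁ : Measurable fun x => μ.real (Ioo s x) :=
    Monotone.measurable fun x y h => measureReal_mono (Ioo_subset_Ioo_right h)
  have h₂ : Measurable fun x => μ.real (Ioo x s) :=
    Antitone.measurable fun x y h => measureReal_mono (Ioo_subset_Ioo_left h)
  have : (fun x => μ.real (between s x)) =
      fun x => if s < x then μ.real (Ioo s x) else μ.real (Ioo x s) := by
    funext x
    split_ifs with h
    · rw [between_of_lt h]
    · rcases (not_lt.1 h).lt_or_eq with h | rfl
      · rw [between_of_gt h]
      · simp [between_self]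
  rw [this]
  exact Measurable.ite measurableSet_Ioi h₁ h₂

lemma measure_between_superlevel_le (μ : Measure ℝ) [IsFiniteMeasure μ] (s x τ : ℝ) :
    μ {t ∈ between s x | τ ≤ μ.real (between s t)} ≤
      ENNReal.ofReal (μ.real (between s x) - τ) := by
  have hS : MeasurableSet {t ∈ between s x | τ ≤ μ.real (between s t)} :=
    (measurableSet_between s x).inter
      (measurableSet_le measurable_const (measurable_measureReal_between μ s))
  rw [hS.measure_eq_iSup_isCompact_of_ne_top (measure_ne_top _ _)]
  refine iSup₂_le fun K hKS => iSup_le fun hK => ?_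
  rcases K.eq_empty_or_nonempty with rfl | hne
  · simp
  obtain ⟨t, htK, ht⟩ := hK.exists_isMinOn hne (f := fun t => |t - s|) (by fun_prop)
  obtain ⟨htx, htτ⟩ := hKS htK
  have hsub : between s t ⊆ between s x := by
    simp only [between] at htx ⊢
    rcases le_total s x with h | h
    · simp only [h, inf_of_le_left, sup_of_le_right, mem_Ioo] at htx
      rw [min_eq_left htx.1.le, max_eq_right htx.1.le, min_eq_left h, max_eq_right h]
      exact Ioo_subset_Ioo_right htx.2.le
    · simp only [h, inf_of_le_right, sup_of_le_left, mem_Ioo] at htx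
      rw [min_eq_right htx.2.le, max_eq_left htx.2.le, min_eq_right h, max_eq_left h]
      exact Ioo_subset_Ioo_left htx.1.le
  have hKd : K ⊆ between s x \ between s t := by
    intro y hy
    refine ⟨(hKS hy).1, fun hyt => ?_⟩
    have h1 : |t - s| ≤ |y - s| := ht hy
    simp only [between, mem_Ioo, min_lt_iff, lt_max_iff] at hyt
    rcases le_total s t with h | h <;> rcases le_total s y with h' | h' <;>
      simp only [abs_of_nonneg, abs_of_nonpos, sub_nonneg, sub_nonpos, h, h'] at h1 <;>
      rcases hyt with ⟨h2 | h2, h3 | h3⟩ <;> linarith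
  calc μ K ≤ μ (between s x \ between s t) := measure_mono hKd
    _ = ENNReal.ofReal (μ.real (between s x \ between s t)) := (ofReal_measureReal).symm
    _ ≤ _ := by
      rw [measureReal_sdiff hsub (measurableSet_between s t)]
      exact ENNReal.ofReal_le_ofReal (by linarith)

lemma integral_exp_weight (L : ℝ) :
    ∫ τ in (0 : ℝ)..L, (L - τ) * (2 * Real.exp (2 * τ)) = (Real.exp (2 * L) - 1) / 2 - L := by
  have h : ∀ τ ∈ uIcc 0 L, HasDerivAt
      (fun τ => (L - τ) * Real.exp (2 * τ) + Real.exp (2 * τ) / 2)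
      ((L - τ) * (2 * Real.exp (2 * τ))) τ := by
    intro τ _
    have h1 : HasDerivAt (fun τ : ℝ => Real.exp (2 * τ)) (Real.exp (2 * τ) * (2 * 1)) τ :=
      ((hasDerivAt_id τ).const_mul 2).exp
    have h2 : HasDerivAt (fun τ : ℝ => L - τ) (-1) τ := by
      simpa using (hasDerivAt_id τ).const_sub L
    convert! (h2.mul h1).add (h1.div_const 2) using 1
    ring
  rw [intervalIntegral.integral_eq_sub_of_hasDerivAt h
    (Continuous.intervalIntegrable (by fun_prop) _ _)]
  simp
  ring

lemma integral_two_mul_exp_two_mul (L : ℝ) :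
    ∫ τ in (0 : ℝ)..L, 2 * Real.exp (2 * τ) = Real.exp (2 * L) - 1 := by
  have h : ∀ τ ∈ uIcc 0 L, HasDerivAt (fun τ => Real.exp (2 * τ)) (2 * Real.exp (2 * τ)) τ := by
    intro τ _
    convert! ((hasDerivAt_id τ).const_mul 2).exp using 1
    simp [mul_comm]
  rw [intervalIntegral.integral_eq_sub_of_hasDerivAt h
    (Continuous.intervalIntegrable (by fun_prop) _ _)]
  simp

/-- The exponential weight associated with a finite measure and a base point. -/
def expWeight (μ : Measure ℝ) (s x : ℝ) : ℝ := Real.exp (2 * μ.real (between s x))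

lemma measurable_expWeight (μ : Measure ℝ) [IsFiniteMeasure μ] (s : ℝ) :
    Measurable (expWeight μ s) :=
  Real.measurable_exp.comp ((measurable_measureReal_between μ s).const_mul 2)

lemma one_le_expWeight (μ : Measure ℝ) (s x : ℝ) : 1 ≤ expWeight μ s x :=
  Real.one_le_exp (by positivity)

lemma expWeight_le (μ : Measure ℝ) [IsFiniteMeasure μ] (s x : ℝ) :
    expWeight μ s x ≤ Real.exp (2 * μ.real univ) :=
  Real.exp_le_exp.2
    (mul_le_mul_of_nonneg_left (measureReal_mono (subset_univ _)) zero_le_two)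

lemma BddMeas.integrable {V : Type*} [NormedAddCommGroup V] [MeasurableSpace V] [BorelSpace V]
    [SecondCountableTopology V] {f : ℝ → V} (hf : BddMeas f) (μ : Measure ℝ) [IsFiniteMeasure μ] :
    Integrable f μ := by
  obtain ⟨hm, C, hC⟩ := hf
  exact Integrable.of_bound hm.aestronglyMeasurable C (Eventually.of_forall hC)

lemma bddMeas_expWeight (μ : Measure ℝ) [IsFiniteMeasure μ] (s : ℝ) :
    BddMeas (expWeight μ s) :=
  ⟨measurable_expWeight μ s, _, fun x => by
    rw [Real.norm_of_nonneg (zero_le_one.trans (one_le_expWeight μ s x))]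
    exact expWeight_le μ s x⟩

lemma setIntegral_expWeight_le (μ : Measure ℝ) [IsFiniteMeasure μ] (s x : ℝ) :
    ∫ t in between s x, expWeight μ s t ∂μ ≤ expWeight μ s x / 2 := by
  set L := μ.real (between s x) with hL
  have hL0 : 0 ≤ L := measureReal_nonneg
  have h_integrable := (bddMeas_expWeight μ s).integrable (μ.restrict (between s x))
  have key : ∫⁻ t in between s x, ENNReal.ofReal (expWeight μ s t - 1) ∂μ ≤
      ENNReal.ofReal ((Real.exp (2 * L) - 1) / 2 - L) := by
    have h1 := lintegral_comp_eq_lintegral_meas_le_mul (μ.restrict (between s x))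
      (f := fun t => μ.real (between s t)) (g := fun τ => 2 * Real.exp (2 * τ))
      (Eventually.of_forall fun t => measureReal_nonneg)
      (measurable_measureReal_between μ s).aemeasurable
      (fun t _ => Continuous.intervalIntegrable (by fun_prop) _ _)
      (Eventually.of_forall fun t => by positivity)
    simp only [integral_two_mul_exp_two_mul] at h1
    unfold expWeight
    rw [h1, ← integral_exp_weight L, intervalIntegral.integral_of_le hL0,
      ofReal_integral_eq_lintegral_ofReal]
    · calc _ ≤ ∫⁻ τ in Ioi 0, (Ioc 0 L).indicator
            (fun τ => ENNReal.ofReal ((L - τ) * (2 * Real.exp (2 * τ)))) τ := by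
            refine setLIntegral_mono' measurableSet_Ioi fun τ hτ => ?_
            have hb : (μ.restrict (between s x)) {a | τ ≤ μ.real (between s a)} ≤
                ENNReal.ofReal (L - τ) := by
              rw [Measure.restrict_apply (measurableSet_le measurable_const
                (measurable_measureReal_between μ s)), inter_comm]
              exact measure_between_superlevel_le μ s x τ
            by_cases hτL : τ ≤ L
            · rw [indicator_of_mem (show τ ∈ Ioc 0 L from ⟨hτ, hτL⟩), ENNReal.ofReal_mul (sub_nonneg.2 hτL)]
              gcongr
            · rw [ENNReal.ofReal_of_nonpos (by linarith)] at hb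
              rw [nonpos_iff_eq_zero.1 hb, zero_mul]
              exact zero_le
        _ = _ := by
            rw [lintegral_indicator measurableSet_Ioc, Measure.restrict_restrict measurableSet_Ioc]
            congr 2
            exact inter_eq_left.2 fun τ hτ => hτ.1
    · exact (Continuous.integrableOn_Icc (by fun_prop)).mono_set Ioc_subset_Icc_self
    · refine (ae_restrict_iff' measurableSet_Ioc).2 (Eventually.of_forall fun τ hτ => ?_)
      have := sub_nonneg.2 hτ.2
      change 0 ≤ (L - τ) * (2 * Real.exp (2 * τ))
      positivity
  have h0 : 0 ≤ (Real.exp (2 * L) - 1) / 2 - L := by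
    have := Real.add_one_le_exp (2 * L)
    linarith
  have h2 : ∫ t in between s x, (expWeight μ s t - 1) ∂μ ≤ (Real.exp (2 * L) - 1) / 2 - L := by
    rw [integral_eq_lintegral_of_nonneg_ae
      (Eventually.of_forall fun t => sub_nonneg.2 (one_le_expWeight μ s t))
      ((measurable_expWeight μ s).sub measurable_const).aestronglyMeasurable]
    exact ENNReal.toReal_le_of_le_ofReal h0 key
  rw [integral_sub h_integrable (integrable_const _)] at h2
  simp only [integral_const, MeasurableSet.univ, measureReal_restrict_apply, univ_inter,
    smul_eq_mul, mul_one, ← hL] at h2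
  have : expWeight μ s x = Real.exp (2 * L) := rfl
  rw [this]
  linarith

lemma setIntegral_le_of_le_expWeight (μ : Measure ℝ) [IsFiniteMeasure μ] (s : ℝ) {f : ℝ → ℝ}
    (hf : BddMeas f) {C : ℝ} (hC : 0 ≤ C) (h : ∀ x, f x ≤ C * expWeight μ s x) (x : ℝ) :
    ∫ t in between s x, f t ∂μ ≤ C / 2 * expWeight μ s x := by
  calc ∫ t in between s x, f t ∂μ ≤ ∫ t in between s x, C * expWeight μ s t ∂μ :=
        integral_mono (hf.integrable _) (((bddMeas_expWeight μ s).integrable _).const_mul C) h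
    _ = C * ∫ t in between s x, expWeight μ s t ∂μ := integral_const_mul _ _
    _ ≤ C * (expWeight μ s x / 2) := by gcongr; exact setIntegral_expWeight_le μ s x
    _ = _ := by ring

lemma tendsto_mul_half_pow (C : ℝ) : Tendsto (fun n : ℕ => C * (1 / 2 : ℝ) ^ n) atTop (𝓝 0) := by
  simpa using (tendsto_pow_atTop_nhds_zero_of_lt_one (by norm_num : (0 : ℝ) ≤ 1 / 2)
    (by norm_num)).const_mul C

/-- Grönwall's lemma for a finite measure with possible atoms. -/
lemma eq_zero_of_le_setIntegral_between (μ : Measure ℝ) [IsFiniteMeasure μ] (s : ℝ) {f : ℝ → ℝ}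
    (hf : BddMeas f) (h0 : ∀ x, 0 ≤ f x) (h : ∀ x, f x ≤ ∫ t in between s x, f t ∂μ) (x : ℝ) :
    f x = 0 := by
  obtain ⟨C, hC⟩ := hf.2
  have hC0 : 0 ≤ C := (norm_nonneg _).trans (hC 0)
  have hn : ∀ n : ℕ, ∀ x, f x ≤ C * (1 / 2) ^ n * expWeight μ s x := by
    intro n
    induction n with
    | zero =>
      intro x
      have := one_le_expWeight μ s x
      have h1 := (le_abs_self _).trans (hC x)
      nlinarith
    | succ n ih =>
      intro x
      refine (h x).trans ((setIntegral_le_of_le_expWeight μ s hf (by positivity) ih x).trans_eq ?_)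
      ring
  refine le_antisymm ?_ (h0 x)
  have ht := (tendsto_mul_half_pow C).mul_const (expWeight μ s x)
  rw [zero_mul] at ht
  exact ge_of_tendsto' ht fun n => hn n x

/-- A Volterra-type operator with respect to a finite measure has a fixed point. -/
lemma exists_fixedPoint_of_volterra {V : Type*} [NormedAddCommGroup V] [MeasurableSpace V]
    [BorelSpace V] [SecondCountableTopology V] [CompleteSpace V]
    (μ : Measure ℝ) [IsFiniteMeasure μ] (s : ℝ) (T : (ℝ → V) → ℝ → V)
    (hT : ∀ f, BddMeas f → BddMeas (T f))
    (hlip : ∀ f g, BddMeas f → BddMeas g →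
      ∀ x, ‖T f x - T g x‖ ≤ ∫ t in between s x, ‖f t - g t‖ ∂μ) :
    ∃ f, BddMeas f ∧ T f = f := by
  have hsub : ∀ f g : ℝ → V, BddMeas f → BddMeas g → BddMeas fun t => ‖f t - g t‖ := by
    rintro f g ⟨hf, C, hC⟩ ⟨hg, D, hD⟩
    refine ⟨(hf.sub hg).norm, C + D, fun x => ?_⟩
    rw [norm_norm]
    exact (norm_sub_le _ _).trans (add_le_add (hC x) (hD x))
  set F : ℕ → ℝ → V := fun n => T^[n] 0 with hF
  have hFs : ∀ n, F (n + 1) = T (F n) := fun n => Function.iterate_succ_apply' T n 0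
  have hFb : ∀ n, BddMeas (F n) := by
    intro n
    induction n with
    | zero => exact ⟨measurable_const, 0, fun x => by simp [hF]⟩
    | succ n ih => rw [hFs]; exact hT _ ih
  obtain ⟨C, hC⟩ := (hFb 1).2
  have hC0 : 0 ≤ C := (norm_nonneg _).trans (hC 0)
  have hn : ∀ n : ℕ, ∀ x, ‖F n x - F (n + 1) x‖ ≤ C * (1 / 2) ^ n * expWeight μ s x := by
    intro n
    induction n with
    | zero =>
      intro x
      have := one_le_expWeight μ s x
      have h1 := hC x
      have h2 : F 0 x = 0 := rfl
      rw [h2, zero_sub, norm_neg, zero_add, pow_zero, mul_one]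
      nlinarith
    | succ n ih =>
      intro x
      rw [hFs (n + 1)]
      nth_rewrite 1 [hFs n]
      refine (hlip _ _ (hFb _) (hFb _) x).trans ((setIntegral_le_of_le_expWeight μ s
        (hsub _ _ (hFb _) (hFb _)) (by positivity) ih x).trans_eq ?_)
      ring
  set M := Real.exp (2 * μ.real univ)
  have hd : ∀ x n, dist (F n x) (F (n + 1) x) ≤ (C * M) * (1 / 2) ^ n := by
    intro x n
    rw [dist_eq_norm]
    calc _ ≤ C * (1 / 2) ^ n * expWeight μ s x := hn n x
      _ ≤ C * (1 / 2) ^ n * M := by gcongr; exact expWeight_le μ s x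
      _ = _ := by ring
  choose f hf using fun x => cauchySeq_tendsto_of_complete
    (cauchySeq_of_le_geometric (1 / 2) (C * M) (by norm_num) (hd x))
  have hdist : ∀ x n, dist (F n x) (f x) ≤ (2 * (C * M)) * (1 / 2) ^ n := by
    intro x n
    refine (dist_le_of_le_geometric_of_tendsto (1 / 2) (C * M) (by norm_num) (hd x) (hf x) n).trans_eq
      ?_
    ring
  have hfb : BddMeas f := by
    refine ⟨measurable_of_tendsto_metrizable (fun n => (hFb n).1) (tendsto_pi_nhds.2 hf),
      2 * (C * M), fun x => ?_⟩
    have := hdist x 0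
    have h2 : F 0 x = 0 := rfl
    rw [dist_comm, dist_eq_norm, h2, sub_zero] at this
    simpa using this
  refine ⟨f, hfb, funext fun x => ?_⟩
  have h1 : Tendsto (fun n => F (n + 1) x) atTop (𝓝 (f x)) := (hf x).comp (tendsto_add_atTop_nat 1)
  have h2 : Tendsto (fun n => F (n + 1) x) atTop (𝓝 (T f x)) := by
    rw [tendsto_iff_dist_tendsto_zero]
    refine squeeze_zero (fun _ => dist_nonneg) (fun n => ?_)
      (tendsto_mul_half_pow (2 * (C * M) * μ.real univ))
    rw [dist_eq_norm, hFs]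
    calc _ ≤ ∫ t in between s x, ‖F n t - f t‖ ∂μ := hlip _ _ (hFb n) hfb x
      _ ≤ ∫ t in between s x, (2 * (C * M)) * (1 / 2) ^ n ∂μ :=
        integral_mono ((hsub _ _ (hFb n) hfb).integrable _) (integrable_const _)
          fun t => by simpa [dist_eq_norm] using hdist t n
      _ = μ.real (between s x) * ((2 * (C * M)) * (1 / 2) ^ n) := by simp
      _ ≤ μ.real univ * ((2 * (C * M)) * (1 / 2) ^ n) := by
        exact mul_le_mul_of_nonneg_right (measureReal_mono (subset_univ _)) (by positivity)
      _ = _ := by ring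
  exact tendsto_nhds_unique h2 h1

lemma leftLim_congr_of_eventuallyEq {f g : ℝ → ℝ} {x l : ℝ} (h : f =ᶠ[𝓝[<] x] g)
    (hg : Tendsto g (𝓝[<] x) (𝓝 l)) : leftLim f x = leftLim g x := by
  rw [leftLim_eq_of_tendsto hg, leftLim_eq_of_tendsto (hg.congr' h.symm)]

lemma rightLim_congr_of_eventuallyEq {f g : ℝ → ℝ} {x l : ℝ} (h : f =ᶠ[𝓝[>] x] g)
    (hg : Tendsto g (𝓝[>] x) (𝓝 l)) : rightLim f x = rightLim g x := by
  rw [rightLim_eq_of_tendsto hg, rightLim_eq_of_tendsto (hg.congr' h.symm)]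

/-- The extension of `f` from `[c,d]` to `ℝ` by constants. -/
def clampFun (c d : ℝ) (f : ℝ → ℝ) (x : ℝ) : ℝ := f (max c (min d x))

lemma clampFun_eqOn (c d : ℝ) (f : ℝ → ℝ) : EqOn (clampFun c d f) f (Icc c d) := fun x hx => by
  simp [clampFun, hx.1, hx.2]

lemma max_min_mem_Icc {c d : ℝ} (hcd : c ≤ d) (x : ℝ) : max c (min d x) ∈ Icc c d :=
  ⟨le_max_left _ _, max_le hcd (min_le_left _ _)⟩

lemma boundedVariationOn_clampFun {c d : ℝ} (hcd : c ≤ d) {f : ℝ → ℝ}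
    (hf : BoundedVariationOn f (Icc c d)) : BoundedVariationOn (clampFun c d f) univ := by
  refine ne_top_of_le_ne_top hf (eVariationOn.comp_le_of_monotoneOn f (fun x => max c (min d x))
    (fun x _ y _ h => max_le_max le_rfl (min_le_min le_rfl h)) fun x _ => max_min_mem_Icc hcd x)

lemma BoundedVariationOn.bddMeas {f : ℝ → ℝ} (hf : BoundedVariationOn f univ) : BddMeas f := by
  obtain ⟨p, q, hp, hq, rfl⟩ := hf.locallyBoundedVariationOn.exists_monotoneOn_sub_monotoneOn
  refine ⟨(monotoneOn_univ.1 hp).measurable.sub (monotoneOn_univ.1 hq).measurable,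
    (eVariationOn (p - q) univ).toReal + ‖(p - q) 0‖, fun x => ?_⟩
  have h1 := hf.dist_le (mem_univ x) (mem_univ 0)
  rw [dist_eq_norm] at h1
  linarith [norm_sub_norm_le ((p - q) x) ((p - q) 0)]

lemma LocallyBoundedVariationOn.boundedVariationOn_Icc {f : ℝ → ℝ} {I : Set ℝ} {c d : ℝ}
    (hf : LocallyBoundedVariationOn f I) (hI : Icc c d ⊆ I) :
    BoundedVariationOn f (Icc c d) := by
  rcases le_or_gt c d with h | h
  · exact (hf c d (hI (left_mem_Icc.2 h)) (hI (right_mem_Icc.2 h))).mono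
      (subset_inter hI subset_rfl)
  · rw [Icc_eq_empty h.not_ge]
    exact BoundedVariationOn.of_subsingleton subsingleton_empty

lemma clampFun_eventuallyEq_left {c d x : ℝ} (f : ℝ → ℝ) (hx : x ∈ Ioc c d) :
    clampFun c d f =ᶠ[𝓝[<] x] f := by
  filter_upwards [Ioo_mem_nhdsLT hx.1] with y hy
  exact clampFun_eqOn c d f ⟨hy.1.le, hy.2.le.trans hx.2⟩

lemma clampFun_eventuallyEq_right {c d x : ℝ} (f : ℝ → ℝ) (hx : x ∈ Ico c d) :
    clampFun c d f =ᶠ[𝓝[>] x] f := by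
  filter_upwards [Ioo_mem_nhdsGT hx.2] with y hy
  exact clampFun_eqOn c d f ⟨hx.1.trans hy.1.le, hy.2.le⟩

lemma tendsto_leftLim_of_boundedVariationOn_Icc {c d x : ℝ} {f : ℝ → ℝ}
    (hf : BoundedVariationOn f (Icc c d)) (hx : x ∈ Ioc c d) :
    Tendsto f (𝓝[<] x) (𝓝 (leftLim f x)) := by
  have h := (boundedVariationOn_clampFun (hx.1.le.trans hx.2) hf).tendsto_leftLim x
  have h' := h.congr' (clampFun_eventuallyEq_left f hx)
  rwa [← leftLim_eq_of_tendsto h'] at h'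

lemma tendsto_rightLim_of_boundedVariationOn_Icc {c d x : ℝ} {f : ℝ → ℝ}
    (hf : BoundedVariationOn f (Icc c d)) (hx : x ∈ Ico c d) :
    Tendsto f (𝓝[>] x) (𝓝 (rightLim f x)) := by
  have h := (boundedVariationOn_clampFun (hx.1.trans hx.2.le) hf).tendsto_rightLim x
  have h' := h.congr' (clampFun_eventuallyEq_right f hx)
  rwa [← rightLim_eq_of_tendsto h'] at h'

lemma leftLim_clampFun {c d x : ℝ} {f : ℝ → ℝ}
    (hf : BoundedVariationOn f (Icc c d)) (hx : x ∈ Ioc c d) :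
    leftLim (clampFun c d f) x = leftLim f x :=
  leftLim_congr_of_eventuallyEq (clampFun_eventuallyEq_left f hx)
    (tendsto_leftLim_of_boundedVariationOn_Icc hf hx)

lemma rightLim_clampFun {c d x : ℝ} {f : ℝ → ℝ}
    (hf : BoundedVariationOn f (Icc c d)) (hx : x ∈ Ico c d) :
    rightLim (clampFun c d f) x = rightLim f x :=
  rightLim_congr_of_eventuallyEq (clampFun_eventuallyEq_right f hx)
    (tendsto_rightLim_of_boundedVariationOn_Icc hf hx)

/-- `ν` is the Lebesgue–Stieltjes measure of `f` on compact subintervals of `J`. -/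
structure StieltjesRep (ν : SignedMeasure ℝ) (f : ℝ → ℝ) (J : Set ℝ) : Prop where
  Ioc : ∀ x ∈ J, ∀ y ∈ J, x ≤ y → ν (Ioc x y) = rightLim f y - rightLim f x
  singleton : ∀ x ∈ J, ν {x} = jump f x

lemma StieltjesRep.Ioo {ν : SignedMeasure ℝ} {f : ℝ → ℝ} {J : Set ℝ} (h : StieltjesRep ν f J)
    {x y : ℝ} (hx : x ∈ J) (hy : y ∈ J) (hxy : x < y) :
    ν (Ioo x y) = leftLim f y - rightLim f x := by
  have h1 : ν (Set.Ioo x y ∪ {y}) = ν (Set.Ioo x y) + ν {y} :=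
    VectorMeasure.of_union (by simp) measurableSet_Ioo (measurableSet_singleton y)
  rw [Ioo_union_right hxy, h.Ioc x hx y hy hxy.le, h.singleton y hy, jump] at h1
  linarith

lemma StieltjesRep.Ico {ν : SignedMeasure ℝ} {f : ℝ → ℝ} {J : Set ℝ} (h : StieltjesRep ν f J)
    {x y : ℝ} (hx : x ∈ J) (hy : y ∈ J) (hxy : x < y) :
    ν (Ico x y) = leftLim f y - leftLim f x := by
  have h1 : ν (Set.Ioo x y ∪ {x}) = ν (Set.Ioo x y) + ν {x} :=
    VectorMeasure.of_union (by simp) measurableSet_Ioo (measurableSet_singleton x)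
  rw [Ioo_union_left hxy, h.Ioo hx hy hxy, h.singleton x hx, jump] at h1
  linarith

lemma StieltjesRep.smRepresents {ν : SignedMeasure ℝ} {f : ℝ → ℝ} {J : Set ℝ}
    (h : StieltjesRep ν f J) {c d : ℝ} (hJ : Icc c d ⊆ J) : SMRepresents ν f c d :=
  fun x hx y hy => h.Ioc x (hJ hx) y (hJ hy)

lemma exists_stieltjesRep {f : ℝ → ℝ} {c d : ℝ} (hf : BoundedVariationOn f (Icc c d)) :
    ∃ ν : SignedMeasure ℝ, StieltjesRep ν f (Ioo c d) := by
  rcases le_or_gt d c with h | h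
  · exact ⟨0, by simp [Ioo_eq_empty h.not_gt], by simp [Ioo_eq_empty h.not_gt]⟩
  have hb := boundedVariationOn_clampFun h.le hf
  refine ⟨hb.vectorMeasure, fun x hx y hy hxy => ?_, fun x hx => ?_⟩
  · rw [hb.vectorMeasure_Ioc hxy, rightLim_clampFun hf ⟨hx.1.le, hx.2⟩,
      rightLim_clampFun hf ⟨hy.1.le, hy.2⟩]
  · rw [hb.vectorMeasure_singleton, rightLim_clampFun hf ⟨hx.1.le, hx.2⟩,
      leftLim_clampFun hf ⟨hx.1, hx.2.le⟩, jump]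

lemma eq_of_smRepresents {ν ν' : SignedMeasure ℝ} {f : ℝ → ℝ} {c d : ℝ} (h : SMRepresents ν f c d)
    (h' : SMRepresents ν' f c d) {E : Set ℝ} (hE : MeasurableSet E)
    (hEs : E ⊆ Ioc c d) : ν E = ν' E := by
  have hI : ∀ x y : ℝ, ν (Ioc x y ∩ Ioc c d) = ν' (Ioc x y ∩ Ioc c d) := by
    intro x y
    rw [Ioc_inter_Ioc]
    rcases le_total (max x c) (min y d) with hxy | hxy
    · have h1 : max x c ∈ Icc c d := ⟨le_max_right _ _, hxy.trans (min_le_right _ _)⟩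
      have h2 : min y d ∈ Icc c d := ⟨(le_max_right _ _).trans hxy, min_le_right _ _⟩
      rw [h _ h1 _ h2 hxy, h' _ h1 _ h2 hxy]
    · rw [Ioc_eq_empty hxy.not_gt]; simp
  have key : ∀ t, MeasurableSet t → ν (t ∩ Ioc c d) = ν' (t ∩ Ioc c d) := by
    intro t ht
    induction t, ht using MeasurableSpace.induction_on_inter
      ((BorelSpace.measurable_eq (α := ℝ)).trans (borel_eq_generateFrom_Ioc ℝ))
      (isPiSystem_Ioc (id : ℝ → ℝ) id) with
    | empty => simp
    | basic t ht =>
      obtain ⟨x, y, -, rfl⟩ := ht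
      exact hI x y
    | compl t ht ih =>
      have e : tᶜ ∩ Ioc c d = Ioc c d \ (t ∩ Ioc c d) := by
        ext z; simp only [mem_inter_iff, mem_compl_iff, Set.mem_sdiff]; tauto
      have hfull : ν (Ioc c d) = ν' (Ioc c d) := by simpa using hI c d
      rw [e, VectorMeasure.of_sdiff (ht.inter measurableSet_Ioc) measurableSet_Ioc
        inter_subset_right, VectorMeasure.of_sdiff (ht.inter measurableSet_Ioc) measurableSet_Ioc
        inter_subset_right, hfull, ih]
    | iUnion g hg hm ih =>
      rw [iUnion_inter]
      have hd : Pairwise (Disjoint on fun i => g i ∩ Ioc c d) := fun i j hij =>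
        (hg hij).mono inter_subset_left inter_subset_left
      have h1 := VectorMeasure.hasSum_of_disjoint_iUnion (v := ν)
        (fun i => (hm i).inter measurableSet_Ioc) hd
      have h2 := VectorMeasure.hasSum_of_disjoint_iUnion (v := ν')
        (fun i => (hm i).inter measurableSet_Ioc) hd
      simp only [ih] at h1
      exact h1.unique h2
  have := key E hE
  rwa [inter_eq_left.2 hEs] at this

lemma signedMeasure_eq_sub (ν : SignedMeasure ℝ) {E : Set ℝ} (hE : MeasurableSet E) :
    ν E = ν.toJordanDecomposition.posPart.real E - ν.toJordanDecomposition.negPart.real E := by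
  conv_lhs => rw [← ν.toSignedMeasure_toJordanDecomposition]
  exact Measure.toSignedMeasure_sub_apply hE

instance isFiniteMeasure_totalVariation (ν : SignedMeasure ℝ) :
    IsFiniteMeasure ν.totalVariation := by
  unfold SignedMeasure.totalVariation; infer_instance

lemma abs_signedMeasure_le (ν : SignedMeasure ℝ) {E : Set ℝ} (hE : MeasurableSet E) :
    |ν E| ≤ ν.totalVariation.real E := by
  rw [signedMeasure_eq_sub ν hE, SignedMeasure.totalVariation, measureReal_add_apply]
  refine (abs_sub _ _).trans_eq ?_
  rw [abs_of_nonneg measureReal_nonneg, abs_of_nonneg measureReal_nonneg]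

lemma sInt_congr (ν : SignedMeasure ℝ) {h k : ℝ → ℝ} {E : Set ℝ} (hE : MeasurableSet E)
    (hk : EqOn h k E) : sInt ν h E = sInt ν k E := by
  rw [sInt, sInt, setIntegral_congr_fun hE hk, setIntegral_congr_fun hE hk]

lemma sInt_singleton (ν : SignedMeasure ℝ) (h : ℝ → ℝ) (t : ℝ) :
    sInt ν h {t} = h t * ν {t} := by
  rw [sInt, integral_singleton, integral_singleton,
    signedMeasure_eq_sub ν (measurableSet_singleton t), smul_eq_mul, smul_eq_mul]
  ring

lemma sInt_zero (ν : SignedMeasure ℝ) (E : Set ℝ) : sInt ν (fun _ => 0) E = 0 := by simp [sInt]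

lemma abs_sInt_sub_le (ν : SignedMeasure ℝ) {h k : ℝ → ℝ} (hh : BddMeas h) (hk : BddMeas k)
    (E : Set ℝ) :
    |sInt ν h E - sInt ν k E| ≤ ∫ t in E, |h t - k t| ∂ν.totalVariation := by
  have hi : ∀ μ : Measure ℝ, IsFiniteMeasure μ → Integrable h μ := fun μ _ => hh.integrable μ
  have ki : ∀ μ : Measure ℝ, IsFiniteMeasure μ → Integrable k μ := fun μ _ => hk.integrable μ
  set P := ν.toJordanDecomposition.posPart
  set N := ν.toJordanDecomposition.negPart
  have e : sInt ν h E - sInt ν k E =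
      (∫ t in E, (h t - k t) ∂P) - ∫ t in E, (h t - k t) ∂N := by
    rw [integral_sub (hi _ inferInstance) (ki _ inferInstance),
      integral_sub (hi _ inferInstance) (ki _ inferInstance), sInt, sInt]
    ring
  rw [e, SignedMeasure.totalVariation, Measure.restrict_add, integral_add_measure
    (f := fun t => |h t - k t|) ((hi _ inferInstance).sub (ki _ inferInstance)).abs
    ((hi _ inferInstance).sub (ki _ inferInstance)).abs]
  exact (abs_sub _ _).trans (add_le_add abs_integral_le_integral_abs abs_integral_le_integral_abs)

lemma sInt_eq_integral_sub_integral {ν : SignedMeasure ℝ} {P Q : Measure ℝ} [IsFiniteMeasure P]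
    [IsFiniteMeasure Q] {E : Set ℝ} (hE : MeasurableSet E)
    (hν : ∀ F ⊆ E, MeasurableSet F → ν F = P.real F - Q.real F) {h : ℝ → ℝ} (hh : BddMeas h) :
    sInt ν h E = (∫ t in E, h t ∂P) - ∫ t in E, h t ∂Q := by
  have hm : (ν.toJordanDecomposition.posPart + Q).restrict E =
      (ν.toJordanDecomposition.negPart + P).restrict E := by
    ext F hF
    rw [Measure.restrict_apply hF, Measure.restrict_apply hF]
    have := hν (F ∩ E) inter_subset_right (hF.inter hE)
    rw [signedMeasure_eq_sub ν (hF.inter hE)] at this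
    rw [← ENNReal.toReal_eq_toReal_iff' (measure_ne_top _ _) (measure_ne_top _ _)]
    change (ν.toJordanDecomposition.posPart + Q).real _ =
      (ν.toJordanDecomposition.negPart + P).real _
    rw [measureReal_add_apply, measureReal_add_apply]
    linarith
  have := congrArg (fun μ => ∫ t, h t ∂μ) hm
  simp only [Measure.restrict_add] at this
  rw [integral_add_measure (hh.integrable _) (hh.integrable _),
    integral_add_measure (hh.integrable _) (hh.integrable _)] at this
  rw [sInt]
  linarith

lemma sInt_congr_signedMeasure {ν ν' : SignedMeasure ℝ} {E : Set ℝ} (hE : MeasurableSet E)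
    (hν : ∀ F ⊆ E, MeasurableSet F → ν F = ν' F) {h : ℝ → ℝ} (hh : BddMeas h) :
    sInt ν h E = sInt ν' h E :=
  sInt_eq_integral_sub_integral hE
    (fun F hF hFm => (hν F hF hFm).trans (signedMeasure_eq_sub ν' hFm)) hh

lemma exists_signedMeasure_eq_sInt (ν : SignedMeasure ℝ) {h : ℝ → ℝ} (hh : BddMeas h) :
    ∃ N : SignedMeasure ℝ, ∀ E, MeasurableSet E → N E = sInt ν h E := by
  refine ⟨ν.toJordanDecomposition.posPart.withDensityᵥ h -
    ν.toJordanDecomposition.negPart.withDensityᵥ h, fun E hE => ?_⟩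
  rw [sub_apply, withDensityᵥ_apply (hh.integrable _) hE,
    withDensityᵥ_apply (hh.integrable _) hE, sInt]

/-- Localized form of `dg = h df` with fixed representing measures. -/
lemma MeasureEqOn.apply_eq_sInt {I : Set ℝ} {g h f : ℝ → ℝ} {c d : ℝ}
    (H : MeasureEqOn I g (fun _ : Fin 1 => h) fun _ => f) (hI : Icc c d ⊆ I)
    (hh : BoundedVariationOn h (Icc c d)) {νg ν : SignedMeasure ℝ}
    (hνg : StieltjesRep νg g (Ioo c d)) (hν : StieltjesRep ν f (Ioo c d))
    {x y : ℝ} (hx : c < x) (hy : y < d) {E : Set ℝ} (hE : MeasurableSet E)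
    (hEs : E ⊆ Ioc x y) : νg E = sInt ν h E := by
  rcases le_or_gt y x with h0 | hxy
  · rw [Ioc_eq_empty h0.not_gt, subset_empty_iff] at hEs
    subst hEs
    simp [sInt]
  have hxJ : x ∈ Ioo c d := ⟨hx, hxy.trans hy⟩
  have hyJ : y ∈ Ioo c d := ⟨hx.trans hxy, hy⟩
  have hs : Icc x y ⊆ Ioo c d := fun z hz => ⟨hx.trans_le hz.1, hz.2.trans_lt hy⟩
  obtain ⟨νg', ν', h1, h2, h3⟩ := H x (hI (Ioo_subset_Icc_self hxJ)) y
    (hI (Ioo_subset_Icc_self hyJ)) hxy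
  have hcd : c ≤ d := (hx.trans (hxy.trans hy)).le
  have hcl : EqOn h (clampFun c d h) E := fun z hz =>
    (clampFun_eqOn c d h (Ioo_subset_Icc_self (hs (Ioc_subset_Icc_self (hEs hz))))).symm
  rw [eq_of_smRepresents (hνg.smRepresents hs) h1 hE hEs, h3 E hEs hE]
  simp only [Finset.univ_unique, Fin.default_eq_zero, Finset.sum_singleton]
  rw [sInt_congr _ hE hcl, sInt_congr _ hE hcl]
  exact sInt_congr_signedMeasure hE (fun F hF hFm => eq_of_smRepresents (h2 0)
    (hν.smRepresents hs) hFm (hF.trans hEs)) (boundedVariationOn_clampFun hcd hh).bddMeas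

section MeasureEqOn

variable {I : Set ℝ} {g h f : ℝ → ℝ} {c d : ℝ}

lemma MeasureEqOn.jump_eq (H : MeasureEqOn I g (fun _ : Fin 1 => h) fun _ => f)
    (hI : Icc c d ⊆ I) (hg : BoundedVariationOn g (Icc c d)) (hh : BoundedVariationOn h (Icc c d))
    (hf : BoundedVariationOn f (Icc c d)) {x : ℝ} (hx : x ∈ Ioo c d) :
    jump g x = h x * jump f x := by
  obtain ⟨νg, hνg⟩ := exists_stieltjesRep hg
  obtain ⟨ν, hν⟩ := exists_stieltjesRep hf
  obtain ⟨x', hx'⟩ := exists_between hx.1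
  rw [← hνg.singleton x hx, ← hν.singleton x hx, ← sInt_singleton]
  exact H.apply_eq_sInt hI hh hνg hν hx'.1 hx.2 (measurableSet_singleton x)
    (singleton_subset_iff.2 ⟨hx'.2, le_rfl⟩)

lemma MeasureEqOn.Ioo_eq (H : MeasureEqOn I g (fun _ : Fin 1 => h) fun _ => f)
    (hI : Icc c d ⊆ I) (hg : BoundedVariationOn g (Icc c d)) (hh : BoundedVariationOn h (Icc c d))
    {ν : SignedMeasure ℝ} (hν : StieltjesRep ν f (Ioo c d)) {x y : ℝ} (hx : x ∈ Ioo c d)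
    (hy : y ∈ Ioo c d) (hxy : x < y) :
    leftLim g y - rightLim g x = sInt ν h (Ioo x y) := by
  obtain ⟨νg, hνg⟩ := exists_stieltjesRep hg
  rw [← hνg.Ioo hx hy hxy]
  exact H.apply_eq_sInt hI hh hνg hν hx.1 hy.2 measurableSet_Ioo Ioo_subset_Ioc_self

lemma MeasureEqOn.Ioc_eq (H : MeasureEqOn I g (fun _ : Fin 1 => h) fun _ => f)
    (hI : Icc c d ⊆ I) (hg : BoundedVariationOn g (Icc c d)) (hh : BoundedVariationOn h (Icc c d))
    {ν : SignedMeasure ℝ} (hν : StieltjesRep ν f (Ioo c d)) {x y : ℝ} (hx : x ∈ Ioo c d)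
    (hy : y ∈ Ioo c d) (hxy : x ≤ y) :
    rightLim g y - rightLim g x = sInt ν h (Ioc x y) := by
  obtain ⟨νg, hνg⟩ := exists_stieltjesRep hg
  rw [← hνg.Ioc x hx y hy hxy]
  exact H.apply_eq_sInt hI hh hνg hν hx.1 hy.2 measurableSet_Ioc subset_rfl

lemma MeasureEqOn.Ico_eq (H : MeasureEqOn I g (fun _ : Fin 1 => h) fun _ => f)
    (hI : Icc c d ⊆ I) (hg : BoundedVariationOn g (Icc c d)) (hh : BoundedVariationOn h (Icc c d))
    {ν : SignedMeasure ℝ} (hν : StieltjesRep ν f (Ioo c d)) {x y : ℝ} (hx : x ∈ Ioo c d)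
    (hy : y ∈ Ioo c d) (hxy : x < y) :
    leftLim g y - leftLim g x = sInt ν h (Ico x y) := by
  obtain ⟨νg, hνg⟩ := exists_stieltjesRep hg
  obtain ⟨x', hx'⟩ := exists_between hx.1
  rw [← hνg.Ico hx hy hxy]
  exact H.apply_eq_sInt hI hh hνg hν hx'.1 hy.2 measurableSet_Ico
    fun z hz => ⟨hx'.2.trans_le hz.1, hz.2.le⟩

end MeasureEqOn

lemma exists_abs_inv_le {τ : Measure ℝ} [IsFiniteMeasure τ] {a b : ℝ → ℝ} {M κ : ℝ}
    (ha : ∀ t, |a t| ≤ τ.real {t}) (hb : ∀ t, |b t| ≤ M) :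
    ∃ C, ∀ t, |(1 - κ ^ 2 * a t * b t)⁻¹| ≤ C := by
  have hM : 0 ≤ M := (abs_nonneg _).trans (hb 0)
  set ε : ℝ := 1 / (2 * (κ ^ 2 * M + 1)) with hε
  have hε0 : 0 < ε := by positivity
  have hfin : {t : ℝ | ENNReal.ofReal ε ≤ τ {t}}.Finite :=
    Measure.finite_const_le_meas_of_disjoint_iUnion τ (ENNReal.ofReal_pos.2 hε0)
      (fun t => measurableSet_singleton t)
      (fun x y hxy => by simpa [Function.onFun] using hxy) (measure_ne_top _ _)
  obtain ⟨C, hC⟩ := (hfin.image fun t => |(1 - κ ^ 2 * a t * b t)⁻¹|).bddAbove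
  refine ⟨max C 2, fun t => ?_⟩
  by_cases ht : ENNReal.ofReal ε ≤ τ {t}
  · exact (hC ⟨t, ht, rfl⟩).trans (le_max_left _ _)
  · refine le_trans ?_ (le_max_right _ _)
    have h1 : τ.real {t} < ε := (ENNReal.lt_ofReal_iff_toReal_lt (measure_ne_top _ _)).1
      (not_le.1 ht)
    have h2 : |κ ^ 2 * a t * b t| ≤ 1 / 2 := by
      rw [abs_mul, abs_mul, abs_of_nonneg (sq_nonneg κ)]
      calc κ ^ 2 * |a t| * |b t| ≤ κ ^ 2 * ε * M := by
            gcongr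
            · exact (ha t).trans h1.le
            · exact hb t
        _ = (κ ^ 2 * M) * ε := by ring
        _ ≤ (κ ^ 2 * M + 1) * ε := by gcongr; linarith
        _ = 1 / 2 := by rw [hε]; field_simp
    have h3 := abs_le.1 h2
    rw [abs_inv, abs_of_pos (by linarith)]
    exact inv_le_of_inv_le₀ (by norm_num) (by linarith)

/-- The coefficient selecting left limits to the right of `s` and right limits up to `s`. -/
def sideCoeff (r s t : ℝ) : ℝ := if s < t then 1 - r else -r

/-- First component of the solution `(p, q)` of `p - κ a q = y₁`, `q - κ b p = y₂`. -/
def crossSolve (κ a b : ℝ) (y₁ y₂ : ℝ) : ℝ := (y₁ + κ * a * y₂) * (1 - κ ^ 2 * a * b)⁻¹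

lemma crossSolve_iff {κ a b : ℝ} (h : 1 - κ ^ 2 * a * b ≠ 0) (p q y₁ y₂ : ℝ) :
    (y₁ = p - κ * a * q ∧ y₂ = q - κ * b * p) ↔
      (p = crossSolve κ a b y₁ y₂ ∧ q = crossSolve κ b a y₂ y₁) := by
  have h' : 1 - κ ^ 2 * b * a ≠ 0 := by rwa [mul_right_comm]
  unfold crossSolve
  rw [← div_eq_mul_inv, ← div_eq_mul_inv, eq_div_iff h, eq_div_iff h']
  constructor
  · rintro ⟨rfl, rfl⟩
    constructor <;> ring
  · rintro ⟨h1, h2⟩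
    constructor
    · refine mul_right_cancel₀ h ?_
      linear_combination κ * a * h2 - h1
    · refine mul_right_cancel₀ h ?_
      linear_combination κ * b * h1 - h2

lemma BddMeas.mul {f g : ℝ → ℝ} (hf : BddMeas f) (hg : BddMeas g) :
    BddMeas fun t => f t * g t := by
  obtain ⟨hf, C, hC⟩ := hf
  obtain ⟨hg, D, hD⟩ := hg
  refine ⟨hf.mul hg, C * D, fun t => ?_⟩
  rw [norm_mul]
  exact mul_le_mul (hC t) (hD t) (norm_nonneg _) ((norm_nonneg _).trans (hC t))

lemma BddMeas.add {f g : ℝ → ℝ} (hf : BddMeas f) (hg : BddMeas g) :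
    BddMeas fun t => f t + g t := by
  obtain ⟨hf, C, hC⟩ := hf
  obtain ⟨hg, D, hD⟩ := hg
  exact ⟨hf.add hg, C + D, fun t => (norm_add_le _ _).trans (add_le_add (hC t) (hD t))⟩

lemma bddMeas_const (k : ℝ) : BddMeas fun _ : ℝ => k := ⟨measurable_const, ‖k‖, fun _ => le_rfl⟩

lemma BddMeas.ite {V : Type*} [NormedAddCommGroup V] [MeasurableSpace V] {f g : ℝ → V} {p : ℝ → Prop}
    [DecidablePred p] (hp : MeasurableSet {t | p t}) (hf : BddMeas f) (hg : BddMeas g) :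
    BddMeas fun t => if p t then f t else g t := by
  obtain ⟨hf, C, hC⟩ := hf
  obtain ⟨hg, D, hD⟩ := hg
  refine ⟨Measurable.ite hp hf hg, max C D, fun t => ?_⟩
  by_cases h : p t
  · simpa [h] using Or.inl (hC t)
  · simpa [h] using Or.inr (hD t)

lemma BddMeas.prodMk {f g : ℝ → ℝ} (hf : BddMeas f) (hg : BddMeas g) :
    BddMeas fun t => (f t, g t) := by
  obtain ⟨hf, C, hC⟩ := hf
  obtain ⟨hg, D, hD⟩ := hg
  exact ⟨hf.prodMk hg, max C D, fun t => max_le_max (hC t) (hD t)⟩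

lemma BddMeas.fst {f : ℝ → ℝ × ℝ} (hf : BddMeas f) : BddMeas fun t => (f t).1 := by
  obtain ⟨hf, C, hC⟩ := hf
  exact ⟨hf.fst, C, fun t => (norm_fst_le _).trans (hC t)⟩

lemma BddMeas.snd {f : ℝ → ℝ × ℝ} (hf : BddMeas f) : BddMeas fun t => (f t).2 := by
  obtain ⟨hf, C, hC⟩ := hf
  exact ⟨hf.snd, C, fun t => (norm_snd_le _).trans (hC t)⟩

lemma bddMeas_sideCoeff (r s : ℝ) : BddMeas (sideCoeff r s) :=
  BddMeas.ite measurableSet_Ioi (bddMeas_const _) (bddMeas_const _)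

open Classical in
lemma bddMeas_jump {f : ℝ → ℝ} {c d : ℝ} (hf : BoundedVariationOn f (Icc c d)) :
    BddMeas fun t => if t ∈ Ioo c d then jump f t else 0 := by
  rcases le_or_gt d c with h | h
  · simpa [Ioo_eq_empty h.not_gt] using bddMeas_const 0
  have hb := boundedVariationOn_clampFun h.le hf
  have h1 : BddMeas fun t => rightLim (clampFun c d f) t + -1 * leftLim (clampFun c d f) t :=
    hb.rightLim.bddMeas.add ((bddMeas_const (-1)).mul hb.leftLim.bddMeas)
  convert! BddMeas.ite measurableSet_Ioo h1 (bddMeas_const 0) using 1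
  funext t
  by_cases ht : t ∈ Ioo c d
  · change ite _ _ _ = ite (t ∈ Ioo c d) _ _
    rw [if_pos ht, if_pos ht, rightLim_clampFun hf ⟨ht.1.le, ht.2⟩,
      leftLim_clampFun hf ⟨ht.1, ht.2.le⟩, jump]
    ring
  · change ite _ _ _ = ite (t ∈ Ioo c d) _ _
    rw [if_neg ht, if_neg ht]

open Classical in
lemma exists_abs_jump_le {f : ℝ → ℝ} {c d : ℝ} (hf : BoundedVariationOn f (Icc c d)) :
    ∃ τ : Measure ℝ, IsFiniteMeasure τ ∧
      ∀ t, |if t ∈ Ioo c d then jump f t else 0| ≤ τ.real {t} := by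
  obtain ⟨ν, hν⟩ := exists_stieltjesRep hf
  refine ⟨ν.totalVariation, inferInstance, fun t => ?_⟩
  split_ifs with h
  · rw [← hν.singleton t h]
    exact abs_signedMeasure_le ν (measurableSet_singleton t)
  · simp

/-- A family of Lipschitz maps recovering `(u, w)` from one-sided limits. -/
structure Resolvent (c d r s : ℝ) (α β : ℝ → ℝ) (U W : ℝ → ℝ × ℝ → ℝ) (C : NNReal) : Prop where
  lipU : ∀ t y z, |U t y - U t z| ≤ C * ‖y - z‖
  lipW : ∀ t y z, |W t y - W t z| ≤ C * ‖y - z‖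
  bddMeasU : ∀ y, BddMeas y → BddMeas fun t => U t (y t)
  bddMeasW : ∀ y, BddMeas y → BddMeas fun t => W t (y t)
  iff : ∀ t ∈ Ioo c d, ∀ p q : ℝ, ∀ y : ℝ × ℝ,
    (y.1 = p - sideCoeff r s t * jump α t * q ∧ y.2 = q - sideCoeff r s t * jump β t * p) ↔
      (p = U t y ∧ q = W t y)

lemma abs_crossSolve_sub_le {κ a b K A D y₁ y₂ z₁ z₂ N : ℝ} (hκ : |κ| ≤ K) (ha : |a| ≤ A)
    (hD : |(1 - κ ^ 2 * a * b)⁻¹| ≤ D) (h₁ : |y₁ - z₁| ≤ N) (h₂ : |y₂ - z₂| ≤ N) :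
    |crossSolve κ a b y₁ y₂ - crossSolve κ a b z₁ z₂| ≤ (1 + K * A) * D * N := by
  have e : crossSolve κ a b y₁ y₂ - crossSolve κ a b z₁ z₂ =
      ((y₁ - z₁) + κ * a * (y₂ - z₂)) * (1 - κ ^ 2 * a * b)⁻¹ := by unfold crossSolve; ring
  have hN : 0 ≤ N := (abs_nonneg _).trans h₁
  have hK : 0 ≤ K := (abs_nonneg _).trans hκ
  have hA : 0 ≤ A := (abs_nonneg _).trans ha
  rw [e, abs_mul]
  calc _ ≤ (N + K * A * N) * D := by
        gcongr
        refine (abs_add_le _ _).trans (add_le_add h₁ ?_)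
        rw [abs_mul, abs_mul]
        gcongr
    _ = _ := by ring

open Classical in
lemma exists_resolvent {c d r : ℝ} {α β : ℝ → ℝ} (s : ℝ) (hα : BoundedVariationOn α (Icc c d))
    (hβ : BoundedVariationOn β (Icc c d))
    (hθ : ∀ x ∈ Ioo c d, theta α β (1 - r) x ≠ 0 ∧ theta α β r x ≠ 0) :
    ∃ U W C, Resolvent c d r s α β U W C := by
  set a : ℝ → ℝ := fun t => if t ∈ Ioo c d then jump α t else 0 with ha
  set b : ℝ → ℝ := fun t => if t ∈ Ioo c d then jump β t else 0 with hb
  have ham : BddMeas a := bddMeas_jump hα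
  have hbm : BddMeas b := bddMeas_jump hβ
  have hκm := bddMeas_sideCoeff r s
  obtain ⟨A, hA⟩ := ham.2
  obtain ⟨B, hB⟩ := hbm.2
  obtain ⟨K, hK⟩ := hκm.2
  obtain ⟨τ, hτ, hτa⟩ := exists_abs_jump_le hα
  have hD : ∀ t, 1 - (1 - r) ^ 2 * a t * b t ≠ 0 ∧ 1 - (-r) ^ 2 * a t * b t ≠ 0 := by
    intro t
    by_cases ht : t ∈ Ioo c d
    · simp only [ha, hb, if_pos ht, neg_sq]
      exact hθ t ht
    · simp only [ha, hb, if_neg ht, mul_zero, sub_zero]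
      exact ⟨one_ne_zero, one_ne_zero⟩
  have hDs : ∀ t, 1 - sideCoeff r s t ^ 2 * a t * b t ≠ 0 := by
    intro t
    unfold sideCoeff
    split_ifs
    exacts [(hD t).1, (hD t).2]
  obtain ⟨D₁, hD₁⟩ := exists_abs_inv_le (κ := 1 - r) hτa hB
  obtain ⟨D₂, hD₂⟩ := exists_abs_inv_le (κ := -r) hτa hB
  have hDb : ∀ t, |(1 - sideCoeff r s t ^ 2 * a t * b t)⁻¹| ≤ max D₁ D₂ := by
    intro t
    unfold sideCoeff
    split_ifs
    exacts [(hD₁ t).trans (le_max_left _ _), (hD₂ t).trans (le_max_right _ _)]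
  have hDm : BddMeas fun t => (1 - sideCoeff r s t ^ 2 * a t * b t)⁻¹ :=
    ⟨((measurable_const.sub (((hκm.1.pow_const 2).mul ham.1).mul hbm.1))).inv, _, hDb⟩
  have hDc : ∀ t, 1 - sideCoeff r s t ^ 2 * b t * a t = 1 - sideCoeff r s t ^ 2 * a t * b t :=
    fun t => by ring
  set D := max D₁ D₂
  have hD0 : 0 ≤ D := (abs_nonneg _).trans (hDb 0)
  have hA0 : 0 ≤ A := (abs_nonneg _).trans (hA 0)
  have hB0 : 0 ≤ B := (abs_nonneg _).trans (hB 0)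
  have hK0 : 0 ≤ K := (abs_nonneg _).trans (hK 0)
  have hfst : ∀ y z : ℝ × ℝ, |y.1 - z.1| ≤ ‖y - z‖ := fun y z => norm_fst_le (y - z)
  have hsnd : ∀ y z : ℝ × ℝ, |y.2 - z.2| ≤ ‖y - z‖ := fun y z => norm_snd_le (y - z)
  refine ⟨fun t y => crossSolve (sideCoeff r s t) (a t) (b t) y.1 y.2,
    fun t y => crossSolve (sideCoeff r s t) (b t) (a t) y.2 y.1,
    ⟨(1 + K * (A + B)) * D, by positivity⟩, fun t y z => ?_, fun t y z => ?_, fun y hy => ?_,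
    fun y hy => ?_, fun t ht p q y => ?_⟩
  · refine abs_crossSolve_sub_le (hK t) ((hA t).trans (by linarith)) (hDb t) (hfst y z) (hsnd y z)
  · refine abs_crossSolve_sub_le (hK t) ((hB t).trans (by linarith)) ?_ (hsnd y z) (hfst y z)
    rw [hDc]
    exact hDb t
  · exact (hy.fst.add ((hκm.mul ham).mul hy.snd)).mul hDm
  · simp only [crossSolve, hDc]
    exact (hy.snd.add ((hκm.mul hbm).mul hy.fst)).mul hDm
  · have h := crossSolve_iff (hDs t) p q y.1 y.2
    have e1 : a t = jump α t := if_pos ht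
    have e2 : b t = jump β t := if_pos ht
    rw [← e1, ← e2]
    exact h

section Local

variable {I : Set ℝ} {r c d s : ℝ} {α β u w : ℝ → ℝ}

lemma IsHomSol.swap (h : IsHomSol I r α β u w) : IsHomSol I r β α w u :=
  ⟨h.2.1, h.1, h.2.2.2, h.2.2.1⟩

lemma IsHomSol.leftLim_eq (h : IsHomSol I r α β u w) (hI : Icc c d ⊆ I)
    (hα : BoundedVariationOn α (Icc c d)) {x : ℝ} (hx : x ∈ Ioo c d) :
    leftLim u x = u x - (1 - r) * jump α x * w x := by
  have h1 := h.2.2.1.jump_eq hI (h.1.1.boundedVariationOn_Icc hI)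
    (h.2.1.1.boundedVariationOn_Icc hI) hα hx
  have h2 := h.1.2 x (hI (Ioo_subset_Icc_self hx))
  rw [jump] at h1
  linear_combination (-(1 - r)) * h1 - h2

lemma IsHomSol.rightLim_eq (h : IsHomSol I r α β u w) (hI : Icc c d ⊆ I)
    (hα : BoundedVariationOn α (Icc c d)) {x : ℝ} (hx : x ∈ Ioo c d) :
    rightLim u x = u x + r * jump α x * w x := by
  have h1 := h.2.2.1.jump_eq hI (h.1.1.boundedVariationOn_Icc hI)
    (h.2.1.1.boundedVariationOn_Icc hI) hα hx
  have h2 := h.1.2 x (hI (Ioo_subset_Icc_self hx))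
  rw [jump] at h1
  linear_combination r * h1 - h2

/-- The left limit to the right of `s`, the right limit up to `s`. -/
def sideLim (s : ℝ) (f : ℝ → ℝ) (t : ℝ) : ℝ := if s < t then leftLim f t else rightLim f t

lemma IsHomSol.sideLim_eq (h : IsHomSol I r α β u w) (hI : Icc c d ⊆ I)
    (hα : BoundedVariationOn α (Icc c d)) {x : ℝ} (hx : x ∈ Ioo c d) :
    sideLim s u x = u x - sideCoeff r s x * jump α x * w x := by
  unfold sideLim sideCoeff
  split_ifs
  · exact h.leftLim_eq hI hα hx
  · rw [h.rightLim_eq hI hα hx]; ring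

open Classical in
lemma bddMeas_sideLim {f : ℝ → ℝ} (s : ℝ) (hf : BoundedVariationOn f (Icc c d)) :
    BddMeas fun t => if t ∈ Ioo c d then sideLim s f t else 0 := by
  rcases le_or_gt d c with h | h
  · simpa [Ioo_eq_empty h.not_gt] using bddMeas_const 0
  have hb := boundedVariationOn_clampFun h.le hf
  have h1 := BddMeas.ite (measurableSet_Ioi (a := s)) hb.leftLim.bddMeas hb.rightLim.bddMeas
  convert! BddMeas.ite (measurableSet_Ioo (a := c) (b := d)) h1 (bddMeas_const 0) using 1
  funext t
  by_cases ht : t ∈ Ioo c d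
  · simp only [if_pos ht, sideLim]
    change _ = ite (t ∈ Ioo c d) _ _
    rw [if_pos ht, rightLim_clampFun hf ⟨ht.1.le, ht.2⟩, leftLim_clampFun hf ⟨ht.1, ht.2.le⟩]
  · change ite _ _ _ = ite (t ∈ Ioo c d) _ _
    rw [if_neg ht, if_neg ht]

/-- The measure controlling the Volterra operator of the system. -/
def volterraMeasure (C : NNReal) (να νβ : SignedMeasure ℝ) : Measure ℝ :=
  C • (να.totalVariation + νβ.totalVariation)

instance (C : NNReal) (να νβ : SignedMeasure ℝ) : IsFiniteMeasure (volterraMeasure C να νβ) := by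
  unfold volterraMeasure; infer_instance

lemma volterraMeasure_comm (C : NNReal) (να νβ : SignedMeasure ℝ) :
    volterraMeasure C να νβ = volterraMeasure C νβ να := by
  rw [volterraMeasure, volterraMeasure, add_comm]

lemma BddMeas.norm_sub {y z : ℝ → ℝ × ℝ} (hy : BddMeas y) (hz : BddMeas z) :
    BddMeas fun t => ‖y t - z t‖ := by
  obtain ⟨hf, C, hC⟩ := hy
  obtain ⟨hg, D, hD⟩ := hz
  refine ⟨(hf.sub hg).norm, C + D, fun x => ?_⟩
  rw [norm_norm]
  exact (norm_sub_le _ _).trans (add_le_add (hC x) (hD x))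

lemma abs_sInt_sub_le_volterra {να νβ : SignedMeasure ℝ} {C : NNReal} {y z : ℝ → ℝ × ℝ}
    {f g : ℝ → ℝ} (hy : BddMeas y) (hz : BddMeas z) (hf : BddMeas f) (hg : BddMeas g)
    (hfg : ∀ t, |f t - g t| ≤ C * ‖y t - z t‖) (E : Set ℝ) :
    |sInt να f E - sInt να g E| ≤ ∫ t in E, ‖y t - z t‖ ∂(volterraMeasure C να νβ) := by
  have hn := hy.norm_sub hz
  have hle : ∫ t in E, ‖y t - z t‖ ∂να.totalVariation ≤
      ∫ t in E, ‖y t - z t‖ ∂(να.totalVariation + νβ.totalVariation) :=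
    integral_mono_measure (Measure.restrict_mono le_rfl (Measure.le_add_right le_rfl))
      (Eventually.of_forall fun t => norm_nonneg _) (hn.integrable _)
  calc _ ≤ ∫ t in E, |f t - g t| ∂να.totalVariation := abs_sInt_sub_le να hf hg E
    _ ≤ ∫ t in E, C * ‖y t - z t‖ ∂να.totalVariation := by
        refine integral_mono_of_nonneg (Eventually.of_forall fun t => abs_nonneg _)
          ((hn.integrable _).const_mul _) (Eventually.of_forall hfg)
    _ = C * ∫ t in E, ‖y t - z t‖ ∂να.totalVariation := integral_const_mul _ _
    _ ≤ C * ∫ t in E, ‖y t - z t‖ ∂(να.totalVariation + νβ.totalVariation) := by gcongr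
    _ = _ := by
        rw [volterraMeasure, Measure.restrict_smul, integral_smul_nnreal_measure]
        rfl

lemma IsHomSol.sideLim_sub (h : IsHomSol I r α β u w) (hI : Icc c d ⊆ I)
    {ν : SignedMeasure ℝ} (hν : StieltjesRep ν α (Ioo c d)) {x : ℝ} (hs : s ∈ Ioo c d)
    (hx : x ∈ Ioo c d) :
    sideLim s u x = if s < x then rightLim u s + sInt ν w (between s x) else
      if x < s then leftLim u s - sInt ν w (between s x) else rightLim u s := by
  have hu := h.1.1.boundedVariationOn_Icc hI
  have hw := h.2.1.1.boundedVariationOn_Icc hI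
  unfold sideLim
  split_ifs with h1 h2
  · rw [between_of_lt h1, ← h.2.2.1.Ioo_eq hI hu hw hν hs hx h1]; ring
  · rw [between_of_gt h2, ← h.2.2.1.Ioo_eq hI hu hw hν hx hs h2]; ring
  · rw [le_antisymm (not_lt.1 h1) (not_lt.1 h2)]

lemma between_subset_Ioo {x : ℝ} (hs : s ∈ Ioo c d) (hx : x ∈ Ioo c d) :
    between s x ⊆ Ioo c d :=
  Ioo_subset_Ioo (le_min hs.1.le hx.1.le) (max_le hs.2.le hx.2.le)

/-- The first component of the estimate behind uniqueness. -/
lemma IsHomSol.abs_sideLim_sub_le {u₁ w₁ u₂ w₂ : ℝ → ℝ} (h₁ : IsHomSol I r α β u₁ w₁)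
    (h₂ : IsHomSol I r α β u₂ w₂) (hI : Icc c d ⊆ I) (hα : BoundedVariationOn α (Icc c d))
    {να νβ : SignedMeasure ℝ} (hν : StieltjesRep να α (Ioo c d)) {C : NNReal}
    {y z : ℝ → ℝ × ℝ} {f g : ℝ → ℝ} (hy : BddMeas y) (hz : BddMeas z) (hf : BddMeas f)
    (hg : BddMeas g) (hfg : ∀ t, |f t - g t| ≤ C * ‖y t - z t‖) (hw₁ : EqOn w₁ f (Ioo c d))
    (hw₂ : EqOn w₂ g (Ioo c d)) (hs : s ∈ Ioo c d) (hu : u₁ s = u₂ s) (hw : w₁ s = w₂ s)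
    {x : ℝ} (hx : x ∈ Ioo c d) :
    |sideLim s u₁ x - sideLim s u₂ x| ≤
      ∫ t in between s x, ‖y t - z t‖ ∂(volterraMeasure C να νβ) := by
  have hb := between_subset_Ioo hs hx
  have hm := measurableSet_between s x
  have key := abs_sInt_sub_le_volterra (να := να) (νβ := νβ) hy hz hf hg hfg (between s x)
  rw [h₁.sideLim_sub hI hν hs hx, h₂.sideLim_sub hI hν hs hx, h₁.leftLim_eq hI hα hs,
    h₂.leftLim_eq hI hα hs, h₁.rightLim_eq hI hα hs, h₂.rightLim_eq hI hα hs, hu, hw,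
    sInt_congr να hm (hw₁.mono hb), sInt_congr να hm (hw₂.mono hb)]
  split_ifs
  · rwa [add_sub_add_left_eq_sub]
  · rwa [sub_sub_sub_cancel_left, abs_sub_comm]
  · rw [sub_self, abs_zero]
    exact integral_nonneg fun t => norm_nonneg _

open Classical in
lemma IsHomSol.eqOn_Ioo {u₁ w₁ u₂ w₂ : ℝ → ℝ} (h₁ : IsHomSol I r α β u₁ w₁)
    (h₂ : IsHomSol I r α β u₂ w₂) (hI : Icc c d ⊆ I) (hα : BoundedVariationOn α (Icc c d))
    (hβ : BoundedVariationOn β (Icc c d))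
    (hθ : ∀ x ∈ Ioo c d, theta α β (1 - r) x ≠ 0 ∧ theta α β r x ≠ 0)
    (hs : s ∈ Ioo c d) (hu : u₁ s = u₂ s) (hw : w₁ s = w₂ s) :
    EqOn u₁ u₂ (Ioo c d) ∧ EqOn w₁ w₂ (Ioo c d) := by
  obtain ⟨U, W, C, R⟩ := exists_resolvent (r := r) s hα hβ hθ
  obtain ⟨να, hνα⟩ := exists_stieltjesRep hα
  obtain ⟨νβ, hνβ⟩ := exists_stieltjesRep hβ
  have main : ∀ u w, IsHomSol I r α β u w → ∃ y : ℝ → ℝ × ℝ, BddMeas y ∧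
      EqOn u (fun t => U t (y t)) (Ioo c d) ∧ EqOn w (fun t => W t (y t)) (Ioo c d) ∧
      (∀ t ∈ Ioo c d, y t = (sideLim s u t, sideLim s w t)) ∧ ∀ t ∉ Ioo c d, y t = 0 := by
    intro u w h
    have hy : ∀ t ∈ Ioo c d, ((if t ∈ Ioo c d then sideLim s u t else 0,
        if t ∈ Ioo c d then sideLim s w t else 0) : ℝ × ℝ) = (sideLim s u t, sideLim s w t) :=
      fun t ht => by rw [if_pos ht, if_pos ht]
    have hR : ∀ t ∈ Ioo c d, u t = U t (sideLim s u t, sideLim s w t) ∧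
        w t = W t (sideLim s u t, sideLim s w t) := fun t ht =>
      (R.iff t ht _ _ _).1 ⟨h.sideLim_eq hI hα ht, h.swap.sideLim_eq hI hβ ht⟩
    refine ⟨fun t => (if t ∈ Ioo c d then sideLim s u t else 0,
      if t ∈ Ioo c d then sideLim s w t else 0),
      (bddMeas_sideLim s (h.1.1.boundedVariationOn_Icc hI)).prodMk
      (bddMeas_sideLim s (h.2.1.1.boundedVariationOn_Icc hI)), fun t ht => ?_, fun t ht => ?_, hy,
      fun t ht => by simp only [if_neg ht]; rfl⟩
    · simp only [hy t ht]; exact (hR t ht).1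
    · simp only [hy t ht]; exact (hR t ht).2
  obtain ⟨y, hy, hyu, hyw, hyJ, hy0⟩ := main u₁ w₁ h₁
  obtain ⟨z, hz, hzu, hzw, hzJ, hz0⟩ := main u₂ w₂ h₂
  have hzero : ∀ x, ‖y x - z x‖ = 0 := by
    refine eq_zero_of_le_setIntegral_between (volterraMeasure C να νβ) s (hy.norm_sub hz)
      (fun x => norm_nonneg _) fun x => ?_
    by_cases hx : x ∈ Ioo c d
    · rw [hyJ x hx, hzJ x hx]
      refine max_le ?_ ?_
      · exact h₁.abs_sideLim_sub_le h₂ hI hα hνα hy hz (R.bddMeasW y hy) (R.bddMeasW z hz)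
          (fun t => R.lipW t _ _) hyw hzw hs hu hw hx
      · rw [volterraMeasure_comm]
        exact h₁.swap.abs_sideLim_sub_le h₂.swap hI hβ hνβ hy hz (R.bddMeasU y hy)
          (R.bddMeasU z hz) (fun t => R.lipU t _ _) hyu hzu hs hw hu hx
    · rw [hy0 x hx, hz0 x hx, sub_self, norm_zero]
      exact integral_nonneg fun t => norm_nonneg _
  have hyz : y = z := funext fun x => sub_eq_zero.1 (norm_eq_zero.1 (hzero x))
  subst hyz
  exact ⟨fun t ht => (hyu ht).trans (hzu ht).symm, fun t ht => (hyw ht).trans (hzw ht).symm⟩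

end Local

/-- The `r`-balanced distribution function of a signed measure. -/
def balancedCdf (N : SignedMeasure ℝ) (k r x : ℝ) : ℝ := k + r * N (Iio x) + (1 - r) * N (Iic x)

lemma signedMeasure_sub_eq {N : SignedMeasure ℝ} {A B E : Set ℝ} (h : A ∪ E = B)
    (hd : Disjoint A E) (hA : MeasurableSet A) (hE : MeasurableSet E) : N B - N A = N E := by
  rw [← h, VectorMeasure.of_union hd hA hE, add_sub_cancel_left]

lemma signedMeasure_Iio_sub (N : SignedMeasure ℝ) {x y : ℝ} (h : x ≤ y) :
    N (Iio y) - N (Iio x) = N (Ico x y) :=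
  signedMeasure_sub_eq (Iio_union_Ico_eq_Iio h)
    (disjoint_left.2 fun _ h1 h2 => not_le.2 h1 h2.1) measurableSet_Iio measurableSet_Ico

lemma signedMeasure_Iic_sub (N : SignedMeasure ℝ) {x y : ℝ} (h : x ≤ y) :
    N (Iic y) - N (Iic x) = N (Ioc x y) :=
  signedMeasure_sub_eq (Iic_union_Ioc_eq_Iic h)
    (disjoint_left.2 fun _ h1 h2 => not_lt.2 h1 h2.1) measurableSet_Iic measurableSet_Ioc

lemma signedMeasure_Iic_sub_Iio (N : SignedMeasure ℝ) (x : ℝ) :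
    N (Iic x) - N (Iio x) = N {x} :=
  signedMeasure_sub_eq Iio_union_right (by simp) measurableSet_Iio
    (measurableSet_singleton x)

lemma signedMeasure_Iio_sub_Iic (N : SignedMeasure ℝ) {x y : ℝ} (h : x < y) :
    N (Iio y) - N (Iic x) = N (Ioo x y) :=
  signedMeasure_sub_eq (Iic_union_Ioo_eq_Iio h)
    (disjoint_left.2 fun _ h1 h2 => not_lt.2 h1 h2.1) measurableSet_Iic measurableSet_Ioo

lemma boundedVariationOn_balancedCdf (N : SignedMeasure ℝ) (k : ℝ) {r : ℝ}
    (hr : r ∈ Icc (0 : ℝ) 1) : BoundedVariationOn (balancedCdf N k r) univ := by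
  set τ := N.totalVariation
  set G : ℝ → ℝ := fun x => τ.real (Iio x) + τ.real (Iic x) with hG
  have hGm : Monotone G := fun x y h => add_le_add (measureReal_mono (Iio_subset_Iio h))
    (measureReal_mono (Iic_subset_Iic.2 h))
  have hGb : BoundedVariationOn G univ := by
    refine (hGm.monotoneOn univ).boundedVariationOn (C := τ.real univ + τ.real univ)
      fun x _ => ?_
    rw [abs_of_nonneg (by positivity)]
    exact add_le_add (measureReal_mono (subset_univ _)) (measureReal_mono (subset_univ _))
  have hle : ∀ x y, x ≤ y → |balancedCdf N k r y - balancedCdf N k r x| ≤ |G y - G x| := by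
    intro x y hxy
    have e : balancedCdf N k r y - balancedCdf N k r x =
        r * N (Ico x y) + (1 - r) * N (Ioc x y) := by
      rw [← signedMeasure_Iio_sub N hxy, ← signedMeasure_Iic_sub N hxy]
      unfold balancedCdf
      ring
    have h1 := abs_signedMeasure_le N (measurableSet_Ico (a := x) (b := y))
    have h2 := abs_signedMeasure_le N (measurableSet_Ioc (a := x) (b := y))
    have h3 : τ.real (Iio y) = τ.real (Iio x) + τ.real (Ico x y) := by
      have := measureReal_union (μ := τ) (s₁ := Iio x) (s₂ := Ico x y)
        (disjoint_left.2 fun _ h1 h2 => not_le.2 h1 h2.1) measurableSet_Ico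
      rwa [Iio_union_Ico_eq_Iio hxy] at this
    have h4 : τ.real (Iic y) = τ.real (Iic x) + τ.real (Ioc x y) := by
      have := measureReal_union (μ := τ) (s₁ := Iic x) (s₂ := Ioc x y)
        (disjoint_left.2 fun _ h1 h2 => not_lt.2 h1 h2.1) measurableSet_Ioc
      rwa [Iic_union_Ioc_eq_Iic hxy] at this
    have h5 : G y - G x = τ.real (Ico x y) + τ.real (Ioc x y) := by
      simp only [hG, h3, h4]; ring
    rw [e, h5, abs_of_nonneg (a := τ.real _ + τ.real _) (by positivity)]
    refine (abs_add_le _ _).trans (add_le_add ?_ ?_)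
    · rw [abs_mul, abs_of_nonneg hr.1]
      exact (mul_le_of_le_one_left (abs_nonneg _) hr.2).trans h1
    · rw [abs_mul, abs_of_nonneg (sub_nonneg.2 hr.2)]
      exact (mul_le_of_le_one_left (abs_nonneg _) (by linarith [hr.1])).trans h2
  refine ne_top_of_le_ne_top hGb (iSup_le fun p => ?_)
  refine le_trans (Finset.sum_le_sum fun i _ => ?_)
    (eVariationOn.sum_le (f := G) (s := univ) (n := p.1) p.2.2.1 fun i => mem_univ _)
  rw [edist_dist, edist_dist]
  exact ENNReal.ofReal_le_ofReal (hle _ _ (p.2.2.1 i.le_succ))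

lemma leftLim_balancedCdf (N : SignedMeasure ℝ) (k : ℝ) {r : ℝ} (hr : r ∈ Icc (0 : ℝ) 1) (x : ℝ) :
    leftLim (balancedCdf N k r) x = k + N (Iio x) := by
  obtain ⟨u, hu, hux, hlim⟩ := exists_seq_strictMono_tendsto x
  have h1 : Tendsto (fun n => N (Iio (u n))) atTop (𝓝 (N (Iio x))) := by
    have : ⋃ n, Iio (u n) = Iio x := by
      ext z
      simp only [mem_iUnion, mem_Iio]
      exact ⟨fun ⟨n, hn⟩ => hn.trans (hux n), fun hz => (hlim.eventually (lt_mem_nhds hz)).exists⟩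
    rw [← this]
    exact VectorMeasure.tendsto_vectorMeasure_iUnion_atTop_nat
      (fun i j h => Iio_subset_Iio (hu.monotone h)) fun i => measurableSet_Iio
  have h2 : Tendsto (fun n => N (Iic (u n))) atTop (𝓝 (N (Iio x))) := by
    have : ⋃ n, Iic (u n) = Iio x := by
      ext z
      simp only [mem_iUnion, mem_Iio, mem_Iic]
      exact ⟨fun ⟨n, hn⟩ => hn.trans_lt (hux n), fun hz =>
        (hlim.eventually (lt_mem_nhds hz)).exists.imp fun _ => le_of_lt⟩
    rw [← this]
    exact VectorMeasure.tendsto_vectorMeasure_iUnion_atTop_nat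
      (fun i j h => Iic_subset_Iic.2 (hu.monotone h)) fun i => measurableSet_Iic
  have h3 : Tendsto (fun n => balancedCdf N k r (u n)) atTop
      (𝓝 (k + r * N (Iio x) + (1 - r) * N (Iio x))) :=
    ((h1.const_mul r).const_add k).add (h2.const_mul (1 - r))
  have h4 := ((boundedVariationOn_balancedCdf N k hr).tendsto_leftLim x).comp
    (tendsto_nhdsWithin_iff.2 ⟨hlim, Eventually.of_forall hux⟩)
  rw [tendsto_nhds_unique h4 h3]
  ring

lemma rightLim_balancedCdf (N : SignedMeasure ℝ) (k : ℝ) {r : ℝ} (hr : r ∈ Icc (0 : ℝ) 1)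
    (x : ℝ) : rightLim (balancedCdf N k r) x = k + N (Iic x) := by
  obtain ⟨u, hu, hux, hlim⟩ := exists_seq_strictAnti_tendsto x
  have h1 : Tendsto (fun n => N (Iio (u n))) atTop (𝓝 (N (Iic x))) := by
    have : ⋂ n, Iio (u n) = Iic x := by
      ext z
      simp only [mem_iInter, mem_Iio, mem_Iic]
      exact ⟨fun h => ge_of_tendsto' hlim fun n => (h n).le, fun hz n => hz.trans_lt (hux n)⟩
    rw [← this]
    exact VectorMeasure.tendsto_vectorMeasure_iInter_atTop_nat
      (fun i j h => Iio_subset_Iio (hu.antitone h)) fun i => measurableSet_Iio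
  have h2 : Tendsto (fun n => N (Iic (u n))) atTop (𝓝 (N (Iic x))) := by
    have : ⋂ n, Iic (u n) = Iic x := by
      ext z
      simp only [mem_iInter, mem_Iic]
      exact ⟨fun h => ge_of_tendsto' hlim h, fun hz n => hz.trans (hux n).le⟩
    rw [← this]
    exact VectorMeasure.tendsto_vectorMeasure_iInter_atTop_nat
      (fun i j h => Iic_subset_Iic.2 (hu.antitone h)) fun i => measurableSet_Iic
  have h3 : Tendsto (fun n => balancedCdf N k r (u n)) atTop
      (𝓝 (k + r * N (Iic x) + (1 - r) * N (Iic x))) :=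
    ((h1.const_mul r).const_add k).add (h2.const_mul (1 - r))
  have h4 := ((boundedVariationOn_balancedCdf N k hr).tendsto_rightLim x).comp
    (tendsto_nhdsWithin_iff.2 ⟨hlim, Eventually.of_forall hux⟩)
  rw [tendsto_nhds_unique h4 h3]
  ring

lemma rBalanced_balancedCdf (N : SignedMeasure ℝ) (k : ℝ) {r : ℝ} (hr : r ∈ Icc (0 : ℝ) 1)
    (I : Set ℝ) : RBalanced r I (balancedCdf N k r) := by
  refine ⟨((boundedVariationOn_balancedCdf N k hr).mono
    (subset_univ I)).locallyBoundedVariationOn, fun x _ => ?_⟩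
  rw [leftLim_balancedCdf N k hr, rightLim_balancedCdf N k hr, balancedCdf]
  ring

lemma smRepresents_balancedCdf (N : SignedMeasure ℝ) (k : ℝ) {r : ℝ} (hr : r ∈ Icc (0 : ℝ) 1)
    (c d : ℝ) : SMRepresents N (balancedCdf N k r) c d := fun x _ y _ hxy => by
  rw [rightLim_balancedCdf N k hr, rightLim_balancedCdf N k hr, ← signedMeasure_Iic_sub N hxy]
  ring

lemma bddMeas_sInt_between (ν : SignedMeasure ℝ) {h : ℝ → ℝ} (hh : BddMeas h) (s : ℝ) :
    BddMeas fun x => sInt ν h (between s x) := by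
  obtain ⟨N, hN⟩ := exists_signedMeasure_eq_sInt ν hh
  simp_rw [← hN _ (measurableSet_between s _)]
  refine ⟨?_, N.totalVariation.real univ, fun x => (abs_signedMeasure_le N
    (measurableSet_between s x)).trans (measureReal_mono (subset_univ _))⟩
  simp_rw [signedMeasure_eq_sub N (measurableSet_between s _)]
  exact (measurable_measureReal_between _ s).sub (measurable_measureReal_between _ s)

section Existence

variable {r c d s : ℝ} {α β : ℝ → ℝ}

/-- The value at `x` of the integrated equation with values `p`, `q` at `s`. -/
def volterraTerm (ν : SignedMeasure ℝ) (r s p m : ℝ) (h : ℝ → ℝ) (x : ℝ) : ℝ :=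
  if x < s then p - (1 - r) * m - sInt ν h (between s x) else p + r * m + sInt ν h (between s x)

lemma bddMeas_volterraTerm (ν : SignedMeasure ℝ) (r s p m : ℝ) {h : ℝ → ℝ} (hh : BddMeas h) :
    BddMeas (volterraTerm ν r s p m h) := by
  have h1 := bddMeas_sInt_between ν hh s
  refine BddMeas.ite measurableSet_Iio ?_ ((bddMeas_const _).add h1)
  simpa [sub_eq_add_neg] using (bddMeas_const (p - (1 - r) * m)).add ((bddMeas_const (-1)).mul h1)

lemma abs_volterraTerm_sub (ν : SignedMeasure ℝ) (r s p m : ℝ) (h k : ℝ → ℝ) (x : ℝ) :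
    |volterraTerm ν r s p m h x - volterraTerm ν r s p m k x| =
      |sInt ν h (between s x) - sInt ν k (between s x)| := by
  unfold volterraTerm
  split_ifs
  · rw [sub_sub_sub_cancel_left, abs_sub_comm]
  · rw [add_sub_add_left_eq_sub]

lemma balancedCdf_eq_of_volterraTerm {ν N : SignedMeasure ℝ} (hν : StieltjesRep ν α (Ioo c d))
    {h : ℝ → ℝ} (hN : ∀ E, MeasurableSet E → N E = sInt ν h E) {p q : ℝ} {f : ℝ → ℝ}
    (hs : s ∈ Ioo c d) (hq : h s = q)
    (hf : ∀ x ∈ Ioo c d, volterraTerm ν r s p (jump α s * q) h x =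
      f x - sideCoeff r s x * jump α x * h x) :
    EqOn (balancedCdf N (p - r * N (Iio s) - (1 - r) * N (Iic s)) r) f (Ioo c d) := by
  intro x hx
  have hNs : N {s} = jump α s * q := by
    rw [hN _ (measurableSet_singleton s), sInt_singleton, hν.singleton s hs, hq, mul_comm]
  have hNx : N {x} = jump α x * h x := by
    rw [hN _ (measurableSet_singleton x), sInt_singleton, hν.singleton x hx, mul_comm]
  have h1 := hf x hx
  have e1 := signedMeasure_Iic_sub_Iio N s
  have e2 := signedMeasure_Iic_sub_Iio N x
  rw [mul_assoc, ← hNx, ← hNs] at h1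
  unfold volterraTerm sideCoeff at h1
  unfold balancedCdf
  rw [← hN _ (measurableSet_between s x)] at h1
  rcases lt_trichotomy x s with hlt | rfl | hlt
  · rw [if_pos hlt, if_neg hlt.not_gt, between_of_gt hlt] at h1
    have e3 := signedMeasure_Iio_sub_Iic N hlt
    rw [← e1, ← e2, ← e3] at h1
    linear_combination h1
  · rw [if_neg (lt_irrefl _), if_neg (lt_irrefl _), between_self, VectorMeasure.empty] at h1
    linear_combination h1
  · rw [if_neg hlt.not_gt, if_pos hlt, between_of_lt hlt] at h1
    have e3 := signedMeasure_Iio_sub_Iic N hlt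
    rw [← e1, ← e2, ← e3] at h1
    linear_combination h1

lemma measureEqOn_balancedCdf (hr : r ∈ Icc (0 : ℝ) 1) {ν N : SignedMeasure ℝ}
    (hν : StieltjesRep ν α (Ioo c d)) {h w : ℝ → ℝ}
    (hN : ∀ E, MeasurableSet E → N E = sInt ν h E) (hw : EqOn w h (Ioo c d)) (k : ℝ) :
    MeasureEqOn (Ioo c d) (balancedCdf N k r) (fun _ : Fin 1 => w) fun _ => α := by
  intro x hx y hy _
  have hJ : Icc x y ⊆ Ioo c d := fun z hz => ⟨hx.1.trans_le hz.1, hz.2.trans_lt hy.2⟩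
  refine ⟨N, fun _ => ν, smRepresents_balancedCdf N k hr x y,
    fun _ => hν.smRepresents hJ, fun E hE hEm => ?_⟩
  simp only [Finset.univ_unique, Finset.sum_singleton]
  rw [hN E hEm]
  exact sInt_congr ν hEm (hw.symm.mono (hE.trans (Ioc_subset_Icc_self.trans hJ)))

open Classical in
lemma exists_isHomSol_Ioo (hr : r ∈ Icc (0 : ℝ) 1) (hα : BoundedVariationOn α (Icc c d))
    (hβ : BoundedVariationOn β (Icc c d))
    (hθ : ∀ x ∈ Ioo c d, theta α β (1 - r) x ≠ 0 ∧ theta α β r x ≠ 0)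
    (hs : s ∈ Ioo c d) (p q : ℝ) :
    ∃ u w, IsHomSol (Ioo c d) r α β u w ∧ u s = p ∧ w s = q := by
  obtain ⟨U, W, C, R⟩ := exists_resolvent (r := r) s hα hβ hθ
  obtain ⟨να, hνα⟩ := exists_stieltjesRep hα
  obtain ⟨νβ, hνβ⟩ := exists_stieltjesRep hβ
  set T : (ℝ → ℝ × ℝ) → ℝ → ℝ × ℝ := fun y x => if x ∈ Ioo c d then
    (volterraTerm να r s p (jump α s * q) (fun t => W t (y t)) x,
      volterraTerm νβ r s q (jump β s * p) (fun t => U t (y t)) x) else 0 with hT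
  obtain ⟨y, hy, hTy⟩ := exists_fixedPoint_of_volterra (volterraMeasure C να νβ) s T
    (fun y hy => BddMeas.ite measurableSet_Ioo
      ((bddMeas_volterraTerm _ _ _ _ _ (R.bddMeasW y hy)).prodMk
      (bddMeas_volterraTerm _ _ _ _ _ (R.bddMeasU y hy))) ⟨measurable_const, 0, fun _ => by simp⟩)
    (by
      intro y z hy hz x
      by_cases hx : x ∈ Ioo c d
      · simp only [hT, if_pos hx]
        refine max_le ?_ ?_
        · refine (abs_volterraTerm_sub _ _ _ _ _ _ _ _).trans_le ?_
          exact abs_sInt_sub_le_volterra hy hz (R.bddMeasW y hy) (R.bddMeasW z hz)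
            (fun t => R.lipW t _ _) _
        · refine (abs_volterraTerm_sub _ _ _ _ _ _ _ _).trans_le ?_
          rw [volterraMeasure_comm]
          exact abs_sInt_sub_le_volterra hy hz (R.bddMeasU y hy) (R.bddMeasU z hz)
            (fun t => R.lipU t _ _) _
      · simp only [hT, if_neg hx, sub_self, norm_zero]
        exact integral_nonneg fun t => norm_nonneg _)
  set f : ℝ → ℝ := fun t => U t (y t) with hf
  set g : ℝ → ℝ := fun t => W t (y t) with hg
  have hyJ : ∀ x ∈ Ioo c d, y x = (volterraTerm να r s p (jump α s * q) g x,
      volterraTerm νβ r s q (jump β s * p) f x) := fun x hx => by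
    conv_lhs => rw [← hTy]
    simp only [hT, if_pos hx]
    rfl
  have hR : ∀ x ∈ Ioo c d,
      volterraTerm να r s p (jump α s * q) g x = f x - sideCoeff r s x * jump α x * g x ∧
      volterraTerm νβ r s q (jump β s * p) f x = g x - sideCoeff r s x * jump β x * f x := by
    intro x hx
    have := (R.iff x hx (f x) (g x) (y x)).2 ⟨rfl, rfl⟩
    rw [hyJ x hx] at this
    exact this
  have hval : p = f s ∧ q = g s := by
    refine (R.iff s hs p q (y s)).1 ?_
    rw [hyJ s hs]
    simp only [volterraTerm, if_neg (lt_irrefl s), between_self, sideCoeff, sInt,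
      Measure.restrict_empty, integral_zero_measure]
    constructor <;> ring
  obtain ⟨N, hN⟩ := exists_signedMeasure_eq_sInt να (R.bddMeasW y hy)
  obtain ⟨M, hM⟩ := exists_signedMeasure_eq_sInt νβ (R.bddMeasU y hy)
  have hu := balancedCdf_eq_of_volterraTerm hνα hN hs hval.2.symm fun x hx => (hR x hx).1
  have hw := balancedCdf_eq_of_volterraTerm hνβ hM hs hval.1.symm fun x hx => (hR x hx).2
  exact ⟨_, _, ⟨rBalanced_balancedCdf N _ hr _, rBalanced_balancedCdf M _ hr _,
    measureEqOn_balancedCdf hr hνα hN hw _, measureEqOn_balancedCdf hr hνβ hM hu _⟩,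
    (hu hs).trans hval.1.symm, (hw hs).trans hval.2.symm⟩

end Existence

section Global

variable {I J : Set ℝ} {r c d s : ℝ} {α β u w : ℝ → ℝ}

lemma leftLim_congr_of_eventuallyEq_nhds {f g : ℝ → ℝ} {x : ℝ} (h : f =ᶠ[𝓝 x] g) :
    leftLim f x = leftLim g x := by
  have h' : f =ᶠ[𝓝[<] x] g := h.filter_mono nhdsWithin_le_nhds
  by_cases hg : ∃ l, Tendsto g (𝓝[<] x) (𝓝 l)
  · exact leftLim_congr_of_eventuallyEq h' hg.choose_spec
  · have hf : ¬∃ l, Tendsto f (𝓝[<] x) (𝓝 l) := fun ⟨l, hl⟩ => hg ⟨l, hl.congr' h'⟩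
    rw [leftLim_eq_of_not_tendsto f hf, leftLim_eq_of_not_tendsto g hg, h.eq_of_nhds]

lemma rightLim_congr_of_eventuallyEq_nhds {f g : ℝ → ℝ} {x : ℝ} (h : f =ᶠ[𝓝 x] g) :
    rightLim f x = rightLim g x := by
  have h' : f =ᶠ[𝓝[>] x] g := h.filter_mono nhdsWithin_le_nhds
  by_cases hg : ∃ l, Tendsto g (𝓝[>] x) (𝓝 l)
  · exact rightLim_congr_of_eventuallyEq h' hg.choose_spec
  · have hf : ¬∃ l, Tendsto f (𝓝[>] x) (𝓝 l) := fun ⟨l, hl⟩ => hg ⟨l, hl.congr' h'⟩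
    rw [rightLim_eq_of_not_tendsto f hf, rightLim_eq_of_not_tendsto g hg, h.eq_of_nhds]

lemma LocallyBoundedVariationOn.mono {f : ℝ → ℝ} (h : LocallyBoundedVariationOn f I)
    (hJ : J ⊆ I) : LocallyBoundedVariationOn f J := fun c d hc hd =>
  (h c d (hJ hc) (hJ hd)).mono (inter_subset_inter_left _ hJ)

lemma RBalanced.mono {f : ℝ → ℝ} (h : RBalanced r I f) (hJ : J ⊆ I) : RBalanced r J f :=
  ⟨h.1.mono hJ, fun x hx => h.2 x (hJ hx)⟩

lemma IsHomSol.mono (h : IsHomSol I r α β u w) (hJ : J ⊆ I) : IsHomSol J r α β u w :=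
  ⟨h.1.mono hJ, h.2.1.mono hJ, fun x hx y hy => h.2.2.1 x (hJ hx) y (hJ hy),
    fun x hx y hy => h.2.2.2 x (hJ hx) y (hJ hy)⟩

lemma RBalanced.of_locally {f : ℝ → ℝ} (h : ∀ x ∈ I, ∀ y ∈ I, ∃ c d f', x ∈ Ioo c d ∧
    y ∈ Ioo c d ∧ RBalanced r (Ioo c d) f' ∧ EqOn f f' (Ioo c d)) : RBalanced r I f := by
  refine ⟨fun x y hx hy => ?_, fun x hx => ?_⟩
  · obtain ⟨c, d, f', hxJ, hyJ, hf', he⟩ := h x hx y hy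
    have hs : I ∩ Icc x y ⊆ Ioo c d := fun z hz =>
      ⟨hxJ.1.trans_le hz.2.1, hz.2.2.trans_lt hyJ.2⟩
    rw [BoundedVariationOn, eVariationOn.congr (he.mono hs)]
    refine BoundedVariationOn.mono (hf'.1 x y hxJ hyJ) (subset_inter hs inter_subset_right)
  · obtain ⟨c, d, f', hxJ, -, hf', he⟩ := h x hx x hx
    have hn := he.eventuallyEq_of_mem (Ioo_mem_nhds hxJ.1 hxJ.2)
    rw [he hxJ, leftLim_congr_of_eventuallyEq_nhds hn, rightLim_congr_of_eventuallyEq_nhds hn]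
    exact hf'.2 x hxJ

lemma MeasureEqOn.of_locally {g h f : ℝ → ℝ} (H : ∀ x ∈ I, ∀ y ∈ I, ∃ c d g' h', x ∈ Ioo c d ∧
    y ∈ Ioo c d ∧ MeasureEqOn (Ioo c d) g' (fun _ : Fin 1 => h') (fun _ => f) ∧
    EqOn g g' (Ioo c d) ∧ EqOn h h' (Ioo c d)) :
    MeasureEqOn I g (fun _ : Fin 1 => h) (fun _ => f) := by
  intro x hx y hy hxy
  obtain ⟨c, d, g', h', hxJ, hyJ, H', hg, hh⟩ := H x hx y hy
  obtain ⟨νg, ν, h1, h2, h3⟩ := H' x hxJ y hyJ hxy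
  have hs : Icc x y ⊆ Ioo c d := fun z hz => ⟨hxJ.1.trans_le hz.1, hz.2.trans_lt hyJ.2⟩
  have hr : ∀ z ∈ Icc x y, rightLim g z = rightLim g' z := fun z hz =>
    rightLim_congr_of_eventuallyEq_nhds
      (hg.eventuallyEq_of_mem (Ioo_mem_nhds (hs hz).1 (hs hz).2))
  refine ⟨νg, ν, fun p hp q hq hpq => ?_, h2, fun E hE hEm => ?_⟩
  · rw [hr p hp, hr q hq, h1 p hp q hq hpq]
  · rw [h3 E hE hEm]
    exact Finset.sum_congr rfl fun j _ =>
      sInt_congr _ hEm (hh.symm.mono (hE.trans (Ioc_subset_Icc_self.trans hs)))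

lemma IsHomSol.of_locally (h : ∀ x ∈ I, ∀ y ∈ I, ∃ c d u' w', x ∈ Ioo c d ∧ y ∈ Ioo c d ∧
    IsHomSol (Ioo c d) r α β u' w' ∧ EqOn u u' (Ioo c d) ∧ EqOn w w' (Ioo c d)) :
    IsHomSol I r α β u w := by
  refine ⟨.of_locally fun x hx y hy => ?_, .of_locally fun x hx y hy => ?_,
    .of_locally fun x hx y hy => ?_, .of_locally fun x hx y hy => ?_⟩ <;>
  obtain ⟨c, d, u', w', hxJ, hyJ, hs, hu, hw⟩ := h x hx y hy
  · exact ⟨c, d, u', hxJ, hyJ, hs.1, hu⟩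
  · exact ⟨c, d, w', hxJ, hyJ, hs.2.1, hw⟩
  · exact ⟨c, d, u', w', hxJ, hyJ, hs.2.2.1, hu, hw⟩
  · exact ⟨c, d, w', u', hxJ, hyJ, hs.2.2.2, hw, hu⟩

lemma exists_Icc_subset_of_mem (hI : IsOpen I) (hc : I.OrdConnected) {x y : ℝ} (hx : x ∈ I)
    (hy : y ∈ I) : ∃ c d, Icc c d ⊆ I ∧ c < x ∧ y < d := by
  obtain ⟨p, q, hp, hpq⟩ := mem_nhds_iff_exists_Ioo_subset.1 (hI.mem_nhds hx)
  obtain ⟨p', q', hp', hpq'⟩ := mem_nhds_iff_exists_Ioo_subset.1 (hI.mem_nhds hy)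
  obtain ⟨c, hc1⟩ := exists_between hp.1
  obtain ⟨d, hd1⟩ := exists_between hp'.2
  exact ⟨c, d, hc.out (hpq ⟨hc1.1, hc1.2.trans hp.2⟩) (hpq' ⟨hp'.1.trans hd1.1, hd1.2⟩),
    hc1.2, hd1.1⟩

lemma exists_Icc_subset_of_mem_of_mem (hI : IsOpen I) (hc : I.OrdConnected) {x y : ℝ}
    (hx : x ∈ I) (hy : y ∈ I) : ∃ c d, Icc c d ⊆ I ∧ x ∈ Ioo c d ∧ y ∈ Ioo c d := by
  rcases le_total x y with h | h
  · obtain ⟨c, d, h1, h2, h3⟩ := exists_Icc_subset_of_mem hI hc hx hy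
    exact ⟨c, d, h1, ⟨h2, h.trans_lt h3⟩, h2.trans_le h, h3⟩
  · obtain ⟨c, d, h1, h2, h3⟩ := exists_Icc_subset_of_mem hI hc hy hx
    exact ⟨c, d, h1, ⟨h2.trans_le h, h3⟩, h2, h.trans_lt h3⟩

lemma IsHomSol.eqOn (hI : IsOpen I) (hc : I.OrdConnected)
    (hα : LocallyBoundedVariationOn α I) (hβ : LocallyBoundedVariationOn β I)
    (hθ : ∀ x ∈ I, theta α β (1 - r) x ≠ 0 ∧ theta α β r x ≠ 0) {u₁ w₁ u₂ w₂ : ℝ → ℝ}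
    (h₁ : IsHomSol I r α β u₁ w₁) (h₂ : IsHomSol I r α β u₂ w₂) (hs : s ∈ I)
    (hu : u₁ s = u₂ s) (hw : w₁ s = w₂ s) : EqOn u₁ u₂ I ∧ EqOn w₁ w₂ I := by
  have key : ∀ x ∈ I, u₁ x = u₂ x ∧ w₁ x = w₂ x := by
    intro x hx
    obtain ⟨c, d, hJ, hsJ, hxJ⟩ := exists_Icc_subset_of_mem_of_mem hI hc hs hx
    have := h₁.eqOn_Ioo h₂ hJ (hα.boundedVariationOn_Icc hJ) (hβ.boundedVariationOn_Icc hJ)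
      (fun y hy => hθ y (hJ (Ioo_subset_Icc_self hy))) hsJ hu hw
    exact ⟨this.1 hxJ, this.2 hxJ⟩
  exact ⟨fun x hx => (key x hx).1, fun x hx => (key x hx).2⟩

lemma exists_isHomSol (hr : r ∈ Icc (0 : ℝ) 1) (hI : IsOpen I) (hc : I.OrdConnected)
    (hα : LocallyBoundedVariationOn α I) (hβ : LocallyBoundedVariationOn β I)
    (hθ : ∀ x ∈ I, theta α β (1 - r) x ≠ 0 ∧ theta α β r x ≠ 0) (hs : s ∈ I) (p q : ℝ) :
    ∃ u w, IsHomSol I r α β u w ∧ u s = p ∧ w s = q := by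
  have ex : ∀ c d, Icc c d ⊆ I → s ∈ Ioo c d →
      ∃ u w, IsHomSol (Ioo c d) r α β u w ∧ u s = p ∧ w s = q := fun c d hJ hsJ =>
    exists_isHomSol_Ioo hr (hα.boundedVariationOn_Icc hJ) (hβ.boundedVariationOn_Icc hJ)
      (fun y hy => hθ y (hJ (Ioo_subset_Icc_self hy))) hsJ p q
  have main : ∀ x, ∃ v : ℝ × ℝ, x ∈ I → ∀ c d u w, Icc c d ⊆ I → s ∈ Ioo c d → x ∈ Ioo c d →
      IsHomSol (Ioo c d) r α β u w → u s = p → w s = q → v.1 = u x ∧ v.2 = w x := by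
    intro x
    by_cases hx : x ∈ I
    swap
    · exact ⟨0, fun h => absurd h hx⟩
    obtain ⟨c, d, hJ, hsJ, hxJ⟩ := exists_Icc_subset_of_mem_of_mem hI hc hs hx
    obtain ⟨u, w, h, hu, hw⟩ := ex c d hJ hsJ
    refine ⟨(u x, w x), fun _ c' d' u' w' hJ' hsJ' hxJ' h' hu' hw' => ?_⟩
    have hK : Ioo c d ∩ Ioo c' d' ⊆ I := fun y hy => hJ (Ioo_subset_Icc_self hy.1)
    have := IsHomSol.eqOn (isOpen_Ioo.inter isOpen_Ioo) (ordConnected_Ioo.inter ordConnected_Ioo)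
      (hα.mono hK) (hβ.mono hK) (fun y hy => hθ y (hK hy)) (h.mono inter_subset_left)
      (h'.mono inter_subset_right) ⟨hsJ, hsJ'⟩ (hu.trans hu'.symm) (hw.trans hw'.symm)
    exact ⟨this.1 ⟨hxJ, hxJ'⟩, this.2 ⟨hxJ, hxJ'⟩⟩
  choose v hv using main
  obtain ⟨c, d, hJ, hsJ, -⟩ := exists_Icc_subset_of_mem_of_mem hI hc hs hs
  obtain ⟨u, w, h, hu, hw⟩ := ex c d hJ hsJ
  have hvs := hv s hs c d u w hJ hsJ hsJ h hu hw
  refine ⟨fun x => (v x).1, fun x => (v x).2, IsHomSol.of_locally fun x hx y hy => ?_,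
    hvs.1.trans hu, hvs.2.trans hw⟩
  have hmin : min x (min y s) ∈ I := by
    rcases min_choice x (min y s) with h | h <;> rcases min_choice y s with h' | h' <;>
      simp_all only
  have hmax : max x (max y s) ∈ I := by
    rcases max_choice x (max y s) with h | h <;> rcases max_choice y s with h' | h' <;>
      simp_all only
  obtain ⟨c, d, hJ, h1, h2⟩ := exists_Icc_subset_of_mem hI hc hmin hmax
  simp only [lt_min_iff, max_lt_iff] at h1 h2
  obtain ⟨u, w, h, hu, hw⟩ := ex c d hJ ⟨h1.2.2, h2.2.2⟩
  have hz : ∀ z ∈ Ioo c d, (v z).1 = u z ∧ (v z).2 = w z := fun z hz =>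
    hv z (hJ (Ioo_subset_Icc_self hz)) c d u w hJ ⟨h1.2.2, h2.2.2⟩ hz h hu hw
  exact ⟨c, d, u, w, ⟨h1.1, h2.1⟩, ⟨h1.2.1, h2.2.1⟩, h, fun z h => (hz z h).1,
    fun z h => (hz z h).2⟩

lemma isHomSol_zero (hI : IsOpen I) (hc : I.OrdConnected) (hα : LocallyBoundedVariationOn α I)
    (hβ : LocallyBoundedVariationOn β I) : IsHomSol I r α β (fun _ => 0) (fun _ => 0) := by
  have hl : ∀ x : ℝ, leftLim (fun _ => (0 : ℝ)) x = 0 := fun x =>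
    leftLim_eq_of_tendsto tendsto_const_nhds
  have hr : ∀ x : ℝ, rightLim (fun _ => (0 : ℝ)) x = 0 := fun x =>
    rightLim_eq_of_tendsto tendsto_const_nhds
  have h1 : RBalanced r I (fun _ => 0) := by
    refine ⟨(monotoneOn_const).locallyBoundedVariationOn, fun x _ => ?_⟩
    rw [hl, hr]; ring
  have h2 : ∀ f, LocallyBoundedVariationOn f I →
      MeasureEqOn I (fun _ => 0) (fun _ : Fin 1 => fun _ => 0) (fun _ => f) := by
    intro f hf x hx y hy _
    obtain ⟨c, d, hJ, hcx, hyd⟩ := exists_Icc_subset_of_mem hI hc hx hy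
    obtain ⟨ν, hν⟩ := exists_stieltjesRep (hf.boundedVariationOn_Icc hJ)
    refine ⟨0, fun _ => ν, fun p _ q _ _ => ?_, fun _ => hν.smRepresents fun z hz =>
      ⟨hcx.trans_le hz.1, hz.2.trans_lt hyd⟩, fun E _ _ => ?_⟩
    · rw [hr, hr]; simp
    · simp [sInt_zero]
  exact ⟨h1, h1, h2 α hα, h2 β hβ⟩

end Global

section Sign

variable {I : Set ℝ} {r c d s e : ℝ} {α β u w : ℝ → ℝ}

/-- Stieltjes measures of monotone functions are given by positive measures. -/
lemma exists_measure_of_stieltjesRep (hm : MonotoneOn α (Icc c d)) {ν : SignedMeasure ℝ}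
    (hν : StieltjesRep ν α (Ioo c d)) (hα : BoundedVariationOn α (Icc c d)) :
    ∃ P : Measure ℝ, IsFiniteMeasure P ∧ ∀ x ∈ Ioo c d, ∀ y ∈ Ioo c d, ∀ F ⊆ Ioc x y,
      MeasurableSet F → ν F = P.real F := by
  rcases le_or_gt d c with h | h
  · exact ⟨0, inferInstance, by simp [Ioo_eq_empty h.not_gt]⟩
  have hc : Monotone (clampFun c d α) := fun x y hxy =>
    hm (max_min_mem_Icc h.le x) (max_min_mem_Icc h.le y) (by gcongr)
  set P := hc.stieltjesFunction.measure.restrict (Icc c d) with hP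
  have hfin : IsFiniteMeasure P := ⟨by
    rw [hP, Measure.restrict_apply_univ, StieltjesFunction.measure_Icc]
    exact ENNReal.ofReal_lt_top⟩
  refine ⟨P, hfin, fun x hx y hy F hF hFm => ?_⟩
  rw [← Measure.toSignedMeasure_apply_measurable hFm]
  have hs : Icc x y ⊆ Ioo c d := fun z hz => ⟨hx.1.trans_le hz.1, hz.2.trans_lt hy.2⟩
  refine eq_of_smRepresents (hν.smRepresents hs) (fun p hp q hq hpq => ?_) hFm hF
  have hp' := hs hp
  have hq' := hs hq
  have hpqJ : Ioc p q ⊆ Icc c d := fun z hz => ⟨hp'.1.le.trans hz.1.le, hz.2.trans hq'.2.le⟩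
  rw [Measure.toSignedMeasure_apply_measurable measurableSet_Ioc, measureReal_def, hP,
    Measure.restrict_apply measurableSet_Ioc, inter_eq_left.2 hpqJ, StieltjesFunction.measure_Ioc,
    hc.stieltjesFunction_eq, hc.stieltjesFunction_eq, rightLim_clampFun hα ⟨hp'.1.le, hp'.2⟩,
    rightLim_clampFun hα ⟨hq'.1.le, hq'.2⟩, ENNReal.toReal_ofReal]
  rw [← rightLim_clampFun hα ⟨hp'.1.le, hp'.2⟩, ← rightLim_clampFun hα ⟨hq'.1.le, hq'.2⟩]
  exact sub_nonneg.2 (hc.rightLim hpq)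

lemma sInt_mul_pos (hm : MonotoneOn α (Icc c d)) (hα : BoundedVariationOn α (Icc c d))
    {ν : SignedMeasure ℝ} (hν : StieltjesRep ν α (Ioo c d)) {f : ℝ → ℝ}
    (hf : BoundedVariationOn f (Icc c d)) {x y : ℝ} (hx : x ∈ Ioo c d) (hy : y ∈ Ioo c d)
    {E : Set ℝ} (hE : MeasurableSet E) (hEs : E ⊆ Ioc x y) (hpos : ∀ t ∈ E, 0 < e * f t)
    (hνE : 0 < ν E) : 0 < e * sInt ν f E := by
  obtain ⟨P, hP, hνP⟩ := exists_measure_of_stieltjesRep hm hν hα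
  have hcE : EqOn f (clampFun c d f) E := fun t ht => (clampFun_eqOn c d f
    ⟨hx.1.le.trans (hEs ht).1.le, (hEs ht).2.trans hy.2.le⟩).symm
  have hb := (boundedVariationOn_clampFun (hx.1.trans hx.2).le hf).bddMeas
  rw [sInt_congr ν hE hcE, sInt_eq_integral_sub_integral (P := P) (Q := 0) hE
    (fun F hF hFm => by rw [hνP x hx y hy F (hF.trans hEs) hFm]; simp) hb,
    Measure.restrict_zero, integral_zero_measure, sub_zero, ← integral_const_mul,
    setIntegral_pos_iff_support_of_nonneg_ae]
  · have hsub : E ⊆ support (fun t => e * clampFun c d f t) ∩ E := fun t ht =>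
      ⟨by rw [mem_support, ← hcE ht]; exact (hpos t ht).ne', ht⟩
    rw [hνP x hx y hy E hEs hE] at hνE
    exact ((ENNReal.toReal_pos_iff.1 hνE).1).trans_le (measure_mono hsub)
  · filter_upwards [ae_restrict_mem hE] with t ht
    rw [← hcE ht]
    exact (hpos t ht).le
  · exact (hb.integrable _).const_mul _

lemma MonotoneOn.leftLim_le_of_mem (hm : MonotoneOn α (Icc c d))
    (hα : BoundedVariationOn α (Icc c d)) {x : ℝ} (hx : x ∈ Ioo c d) : leftLim α x ≤ α x := by
  refine le_of_tendsto (tendsto_leftLim_of_boundedVariationOn_Icc hα ⟨hx.1, hx.2.le⟩) ?_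
  filter_upwards [Ioo_mem_nhdsLT hx.1] with y hy
  exact hm ⟨hy.1.le, (hy.2.trans hx.2).le⟩ (Ioo_subset_Icc_self hx) hy.2.le

lemma MonotoneOn.le_rightLim_of_mem (hm : MonotoneOn α (Icc c d))
    (hα : BoundedVariationOn α (Icc c d)) {x : ℝ} (hx : x ∈ Ioo c d) : α x ≤ rightLim α x := by
  refine ge_of_tendsto (tendsto_rightLim_of_boundedVariationOn_Icc hα ⟨hx.1.le, hx.2⟩) ?_
  filter_upwards [Ioo_mem_nhdsGT hx.2] with y hy
  exact hm (Ioo_subset_Icc_self hx) ⟨(hx.1.trans hy.1).le, hy.2.le⟩ hy.1.le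

lemma MonotoneOn.jump_nonneg (hm : MonotoneOn α (Icc c d))
    (hα : BoundedVariationOn α (Icc c d)) {x : ℝ} (hx : x ∈ Ioo c d) : 0 ≤ jump α x :=
  sub_nonneg.2 ((hm.leftLim_le_of_mem hα hx).trans (hm.le_rightLim_of_mem hα hx))

lemma StrictMonoOn.lt_leftLim_of_lt (hm : StrictMonoOn α (Icc c d))
    (hα : BoundedVariationOn α (Icc c d)) {x y : ℝ} (hx : x ∈ Ioo c d) (hy : y ∈ Ioo c d)
    (hxy : x < y) : α x < leftLim α y := by
  obtain ⟨p, hxp, hpy⟩ := exists_between hxy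
  have hp : p ∈ Icc c d := ⟨(hx.1.trans hxp).le, (hpy.trans hy.2).le⟩
  refine (hm (Ioo_subset_Icc_self hx) hp hxp).trans_le ?_
  refine ge_of_tendsto (tendsto_leftLim_of_boundedVariationOn_Icc hα ⟨hy.1, hy.2.le⟩) ?_
  filter_upwards [Ioo_mem_nhdsLT hpy] with z hz
  exact hm.monotoneOn hp ⟨hp.1.trans hz.1.le, (hz.2.trans hy.2).le⟩ hz.1.le

lemma StrictMonoOn.rightLim_lt_of_lt (hm : StrictMonoOn α (Icc c d))
    (hα : BoundedVariationOn α (Icc c d)) {x y : ℝ} (hx : x ∈ Ioo c d) (hy : y ∈ Ioo c d)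
    (hxy : x < y) : rightLim α x < α y := by
  obtain ⟨p, hxp, hpy⟩ := exists_between hxy
  have hp : p ∈ Icc c d := ⟨(hx.1.trans hxp).le, (hpy.trans hy.2).le⟩
  refine lt_of_le_of_lt ?_ (hm hp (Ioo_subset_Icc_self hy) hpy)
  refine le_of_tendsto (tendsto_rightLim_of_boundedVariationOn_Icc hα ⟨hx.1.le, hx.2⟩) ?_
  filter_upwards [Ioo_mem_nhdsGT hxp] with z hz
  exact hm.monotoneOn ⟨(hx.1.trans hz.1).le, hz.2.le.trans hp.2⟩ hp hz.2.le

lemma IsHomSol.eventually_leftLim_lt (h : IsHomSol I r α β u w) (hI : Icc c d ⊆ I)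
    (hm : StrictMonoOn α (Icc c d)) (hα : BoundedVariationOn α (Icc c d)) (hs : s ∈ Ioo c d)
    (hw : 0 < e * leftLim w s) : ∀ᶠ x in 𝓝[<] s, e * leftLim u x < e * leftLim u s := by
  have hu := h.1.1.boundedVariationOn_Icc hI
  have hw' := h.2.1.1.boundedVariationOn_Icc hI
  obtain ⟨ν, hν⟩ := exists_stieltjesRep hα
  have hev : ∀ᶠ t in 𝓝[<] s, 0 < e * w t :=
    ((tendsto_leftLim_of_boundedVariationOn_Icc hw' ⟨hs.1, hs.2.le⟩).const_mul e).eventually_const_lt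
      hw
  obtain ⟨l, hl, hls⟩ := (mem_nhdsLT_iff_exists_Ioo_subset' hs.1).1 hev
  filter_upwards [Ioo_mem_nhdsLT (max_lt hl hs.1)] with x hx
  have hxl := max_lt_iff.1 hx.1
  have hxJ : x ∈ Ioo c d := ⟨hxl.2, hx.2.trans hs.2⟩
  obtain ⟨x', hx'⟩ := exists_between hxl.2
  rw [← sub_pos, ← mul_sub, h.2.2.1.Ico_eq hI hu hw' hν hxJ hs hx.2]
  refine sInt_mul_pos hm.monotoneOn hα hν hw' ⟨hx'.1, hx'.2.trans hxJ.2⟩ hs measurableSet_Ico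
    (fun z hz => ⟨hx'.2.trans_le hz.1, hz.2.le⟩) (fun t ht => hls ⟨hxl.1.trans_le ht.1, ht.2⟩) ?_
  rw [hν.Ico hxJ hs hx.2, sub_pos]
  exact (hm.monotoneOn.leftLim_le_of_mem hα hxJ).trans_lt (hm.lt_leftLim_of_lt hα hxJ hs hx.2)

lemma IsHomSol.eventually_lt_rightLim (h : IsHomSol I r α β u w) (hI : Icc c d ⊆ I)
    (hm : StrictMonoOn α (Icc c d)) (hα : BoundedVariationOn α (Icc c d)) (hs : s ∈ Ioo c d)
    (hw : 0 < e * rightLim w s) : ∀ᶠ x in 𝓝[>] s, e * rightLim u s < e * rightLim u x := by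
  have hu := h.1.1.boundedVariationOn_Icc hI
  have hw' := h.2.1.1.boundedVariationOn_Icc hI
  obtain ⟨ν, hν⟩ := exists_stieltjesRep hα
  have hev : ∀ᶠ t in 𝓝[>] s, 0 < e * w t :=
    ((tendsto_rightLim_of_boundedVariationOn_Icc hw' ⟨hs.1.le, hs.2⟩).const_mul
      e).eventually_const_lt hw
  obtain ⟨l, hl, hls⟩ := (mem_nhdsGT_iff_exists_Ioo_subset' hs.2).1 hev
  filter_upwards [Ioo_mem_nhdsGT (lt_min hl hs.2)] with x hx
  have hxl := lt_min_iff.1 hx.2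
  have hxJ : x ∈ Ioo c d := ⟨hs.1.trans hx.1, hxl.2⟩
  rw [← sub_pos, ← mul_sub, h.2.2.1.Ioc_eq hI hu hw' hν hs hxJ hx.1.le]
  refine sInt_mul_pos hm.monotoneOn hα hν hw' hs hxJ measurableSet_Ioc subset_rfl
    (fun t ht => hls ⟨ht.1, ht.2.trans_lt hxl.1⟩) ?_
  rw [hν.Ioc s hs x hxJ hx.1.le, sub_pos]
  exact (hm.rightLim_lt_of_lt hα hs hxJ hx.1).trans_le (hm.monotoneOn.le_rightLim_of_mem hα hxJ)

lemma tendsto_leftLim_nhdsLT {f : ℝ → ℝ} (hf : BoundedVariationOn f (Icc c d))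
    (hs : s ∈ Ioo c d) : Tendsto (leftLim f) (𝓝[<] s) (𝓝 (leftLim f s)) :=
  (continuousWithinAt_leftLim_Iic
    (tendsto_leftLim_of_boundedVariationOn_Icc hf ⟨hs.1, hs.2.le⟩)).tendsto.mono_left
      (nhdsWithin_mono _ Iio_subset_Iic_self)

lemma tendsto_rightLim_nhdsGT {f : ℝ → ℝ} (hf : BoundedVariationOn f (Icc c d))
    (hs : s ∈ Ioo c d) : Tendsto (rightLim f) (𝓝[>] s) (𝓝 (rightLim f s)) :=
  (continuousWithinAt_rightLim_Ici
    (tendsto_rightLim_of_boundedVariationOn_Icc hf ⟨hs.1.le, hs.2⟩)).tendsto.mono_left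
      (nhdsWithin_mono _ Ioi_subset_Ici_self)

lemma IsHomSol.eventually_leftLim_pos (h : IsHomSol I r α β u w) (hI : Icc c d ⊆ I)
    (hm : StrictMonoOn α (Icc c d)) (hα : BoundedVariationOn α (Icc c d)) (hs : s ∈ Ioo c d)
    (he : 0 < e * leftLim u s ∨ leftLim u s = 0 ∧ e * leftLim w s < 0) :
    ∀ᶠ x in 𝓝[<] s, 0 < e * leftLim u x := by
  rcases he with he | ⟨h0, he⟩
  · exact ((tendsto_leftLim_nhdsLT (h.1.1.boundedVariationOn_Icc hI)
      hs).const_mul e).eventually_const_lt he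
  · filter_upwards [h.eventually_leftLim_lt (e := -e) hI hm hα hs (by linarith)] with x hx
    rw [h0] at hx
    linarith

lemma IsHomSol.eventually_rightLim_pos (h : IsHomSol I r α β u w) (hI : Icc c d ⊆ I)
    (hm : StrictMonoOn α (Icc c d)) (hα : BoundedVariationOn α (Icc c d)) (hs : s ∈ Ioo c d)
    (he : 0 < e * rightLim u s ∨ rightLim u s = 0 ∧ 0 < e * rightLim w s) :
    ∀ᶠ x in 𝓝[>] s, 0 < e * rightLim u x := by
  rcases he with he | ⟨h0, he⟩
  · exact ((tendsto_rightLim_nhdsGT (h.1.1.boundedVariationOn_Icc hI)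
      hs).const_mul e).eventually_const_lt he
  · filter_upwards [h.eventually_lt_rightLim (e := e) hI hm hα hs he] with x hx
    rwa [h0, mul_zero] at hx

lemma changesSignAt_of_eventually (hI : IsOpen I) (hs : s ∈ I)
    (hl : ∀ᶠ x in 𝓝[<] s, 0 < -e * leftLim u x) (hr : ∀ᶠ x in 𝓝[>] s, 0 < e * rightLim u x) :
    ChangesSignAt I u s := by
  obtain ⟨ε, hε, hεI⟩ := Metric.isOpen_iff.1 hI s hs
  obtain ⟨l, hl1, hl2⟩ := mem_nhdsLT_iff_exists_Ioo_subset.1 hl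
  obtain ⟨m, hm1, hm2⟩ := mem_nhdsGT_iff_exists_Ioo_subset.1 hr
  have hl1 : l < s := hl1
  have hm1 : s < m := hm1
  rw [Real.ball_eq_Ioo] at hεI
  set δ := min ε (min (s - l) (m - s)) with hδ
  have h1 : δ ≤ ε := min_le_left _ _
  have h2 : δ ≤ s - l := (min_le_right _ _).trans (min_le_left _ _)
  have h3 : δ ≤ m - s := (min_le_right _ _).trans (min_le_right _ _)
  have hL : ∀ x ∈ Ioo (s - δ) s, 0 < -e * leftLim u x := fun x hx =>
    hl2 ⟨by linarith [hx.1], hx.2⟩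
  have hR : ∀ x ∈ Ioo s (s + δ), 0 < e * rightLim u x := fun x hx =>
    hm2 ⟨hx.1, by linarith [hx.2]⟩
  refine ⟨δ, lt_min hε (lt_min (sub_pos.2 hl1) (sub_pos.2 hm1)),
    (Ioo_subset_Ioo (by linarith) (by linarith)).trans hεI, ?_⟩
  rcases lt_trichotomy e 0 with he | he | he
  · exact Or.inr ⟨fun x hx => pos_of_mul_pos_right (hL x hx) (by linarith), fun x hx => by
      nlinarith [hR x hx]⟩
  · obtain ⟨x, hx⟩ := hr.exists
    simp [he] at hx
  · exact Or.inl ⟨fun x hx => by nlinarith [hL x hx], fun x hx =>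
      pos_of_mul_pos_right (hR x hx) he.le⟩

lemma ChangesSignAt.eventually (h : ChangesSignAt I u s) : ∃ e, e ^ 2 = 1 ∧
    (∀ᶠ x in 𝓝[<] s, e * leftLim u x < 0) ∧ ∀ᶠ x in 𝓝[>] s, 0 < e * rightLim u x := by
  obtain ⟨δ, hδ, -, ⟨h1, h2⟩ | ⟨h1, h2⟩⟩ := h
  · refine ⟨1, by norm_num, ?_, ?_⟩
    · filter_upwards [Ioo_mem_nhdsLT (sub_lt_self s hδ)] with x hx
      linarith [h1 x hx]
    · filter_upwards [Ioo_mem_nhdsGT (lt_add_of_pos_right s hδ)] with x hx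
      linarith [h2 x hx]
  · refine ⟨-1, by norm_num, ?_, ?_⟩
    · filter_upwards [Ioo_mem_nhdsLT (sub_lt_self s hδ)] with x hx
      linarith [h1 x hx]
    · filter_upwards [Ioo_mem_nhdsGT (lt_add_of_pos_right s hδ)] with x hx
      linarith [h2 x hx]

lemma ChangesSignAt.leftLim_mul_rightLim_nonpos (h : ChangesSignAt I u s)
    (hu : BoundedVariationOn u (Icc c d)) (hs : s ∈ Ioo c d) :
    leftLim u s * rightLim u s ≤ 0 := by
  obtain ⟨e, he, hl, hr⟩ := h.eventually
  have h1 : e * leftLim u s ≤ 0 :=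
    le_of_tendsto ((tendsto_leftLim_nhdsLT hu hs).const_mul e) (hl.mono fun x hx => hx.le)
  have h2 : 0 ≤ e * rightLim u s :=
    ge_of_tendsto ((tendsto_rightLim_nhdsGT hu hs).const_mul e) (hr.mono fun x hx => hx.le)
  calc leftLim u s * rightLim u s = e ^ 2 * (leftLim u s * rightLim u s) := by rw [he, one_mul]
    _ = (e * leftLim u s) * (e * rightLim u s) := by ring
    _ ≤ 0 := mul_nonpos_of_nonpos_of_nonneg h1 h2

lemma ChangesSignAt.not_eventually_pos (h : ChangesSignAt I u s)
    (hl : ∀ᶠ x in 𝓝[<] s, 0 < e * leftLim u x) (hr : ∀ᶠ x in 𝓝[>] s, 0 < e * rightLim u x) :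
    False := by
  obtain ⟨k, -, hl', hr'⟩ := h.eventually
  obtain ⟨x, hx, hx'⟩ := (hl.and hl').exists
  obtain ⟨y, hy, hy'⟩ := (hr.and hr').exists
  have h1 := mul_neg_of_pos_of_neg hx hx'
  have h2 := mul_pos hy hy'
  have h3 : (e * k) * leftLim u x ^ 2 < 0 := by linarith
  have h4 : 0 < (e * k) * rightLim u y ^ 2 := by linarith
  exact absurd (pos_of_mul_pos_left h4 (sq_nonneg _))
    (neg_of_mul_neg_left h3 (sq_nonneg _)).not_gt

end Sign

lemma isOpen_EI (a b : EReal) : IsOpen (EI a b) :=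
  isOpen_Ioo.preimage continuous_coe_real_ereal

lemma ordConnected_EI (a b : EReal) : (EI a b).OrdConnected :=
  ordConnected_Ioo.preimage_mono EReal.coe_strictMono.monotone

section Cases

variable {I : Set ℝ} {r c d s : ℝ} {α β u w : ℝ → ℝ}

lemma IsHomSol.exists_eventually_sign (h : IsHomSol I r α β u w) (hI : Icc c d ⊆ I)
    (hm : StrictMonoOn α (Icc c d)) (hα : BoundedVariationOn α (Icc c d))
    (hβ : BoundedVariationOn β (Icc c d)) (hs : s ∈ Ioo c d) (h0 : ¬(u s = 0 ∧ w s = 0))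
    (hθr : 0 < theta α β r s) (hθ : 0 < theta α β (1 - r) s)
    (hZ : leftLim u s * rightLim u s ≤ 0) : ∃ e,
      (∀ᶠ x in 𝓝[<] s, 0 < -e * leftLim u x) ∧ ∀ᶠ x in 𝓝[>] s, 0 < e * rightLim u x := by
  have hul := h.leftLim_eq hI hα hs
  have hur := h.rightLim_eq hI hα hs
  have hwl := h.swap.leftLim_eq hI hβ hs
  have hwr := h.swap.rightLim_eq hI hβ hs
  have hA := hm.monotoneOn.jump_nonneg hα hs
  rw [theta] at hθ hθr
  by_cases hl : leftLim u s = 0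
  · have hu : u s = (1 - r) * jump α s * w s := by linarith
    have hw : w s ≠ 0 := fun hw => h0 ⟨by rw [hu, hw, mul_zero], hw⟩
    have hw2 := pow_pos (abs_pos.2 hw) 2
    rw [sq_abs] at hw2
    refine ⟨w s, h.eventually_leftLim_pos hI hm hα hs (Or.inr ⟨hl, ?_⟩),
      h.eventually_rightLim_pos hI hm hα hs ?_⟩
    · rw [hwl, hu]
      linarith [mul_pos hw2 hθ]
    · rcases hA.lt_or_eq with hA | hA
      · left
        rw [hur, hu]
        linarith [mul_pos hA hw2]
      · rw [← hA] at hu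
        right
        rw [hur, hwr, hu, ← hA]
        constructor
        · ring
        · linarith
  by_cases hr : rightLim u s = 0
  · have hu : u s = -(r * jump α s * w s) := by linarith
    have hl' : leftLim u s = -(jump α s * w s) := by rw [hul, hu]; ring
    have hw : w s ≠ 0 := fun hw => hl (by rw [hl', hw, mul_zero, neg_zero])
    have hA : 0 < jump α s := hA.lt_of_ne fun hA => hl (by rw [hl', ← hA, zero_mul, neg_zero])
    have hw2 := pow_pos (abs_pos.2 hw) 2
    rw [sq_abs] at hw2
    refine ⟨w s, h.eventually_leftLim_pos hI hm hα hs (Or.inl ?_),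
      h.eventually_rightLim_pos hI hm hα hs (Or.inr ⟨hr, ?_⟩)⟩
    · rw [hl']
      linarith [mul_pos hA hw2]
    · rw [hwr, hu]
      linarith [mul_pos hw2 hθr]
  · refine ⟨rightLim u s, h.eventually_leftLim_pos hI hm hα hs (Or.inl ?_),
      h.eventually_rightLim_pos hI hm hα hs (Or.inl (mul_self_pos.2 hr))⟩
    have := hZ.lt_of_ne (mul_ne_zero hl hr)
    linarith

lemma theta_pos_of_zSet_eq (hr : r ∈ Icc (0 : ℝ) 1) (hI : IsOpen I) (hc : I.OrdConnected)
    (hm : StrictMonoOn α I) (hβ : LocallyBoundedVariationOn β I)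
    (hθ : ∀ x ∈ I, theta α β (1 - r) x ≠ 0 ∧ theta α β r x ≠ 0)
    (H : ∀ u w, IsHomSol I r α β u w → ¬(∀ x ∈ I, u x = 0) →
      ZSet u I = {s ∈ I | ChangesSignAt I u s}) (hs : s ∈ I) :
    0 < theta α β r s ∧ 0 < theta α β (1 - r) s := by
  have hα := hm.monotoneOn.locallyBoundedVariationOn
  obtain ⟨c, d, hJ, hsJ, -⟩ := exists_Icc_subset_of_mem_of_mem hI hc hs hs
  have hαJ := hα.boundedVariationOn_Icc hJ
  have hβJ := hβ.boundedVariationOn_Icc hJ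
  have hmJ := hm.mono hJ
  have hA := hmJ.monotoneOn.jump_nonneg hαJ hsJ
  have key : ∀ z, theta α β z s < 0 → z ≠ 0 ∧ 0 < jump α s := by
    intro z hz
    rw [theta] at hz
    refine ⟨fun h => ?_, hA.lt_of_ne fun h => ?_⟩
    · norm_num [h] at hz
    · norm_num [← h] at hz
  have absurd_of : ∀ u w e, IsHomSol I r α β u w → u s ≠ 0 → leftLim u s * rightLim u s = 0 →
      (∀ᶠ x in 𝓝[<] s, 0 < e * leftLim u x) → (∀ᶠ x in 𝓝[>] s, 0 < e * rightLim u x) →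
      False := by
    intro u w e h hu hz hl hr
    have hZ : s ∈ ZSet u I := ⟨hs, hz.le⟩
    rw [H u w h fun h => hu (h s hs)] at hZ
    exact hZ.2.not_eventually_pos hl hr
  constructor <;> refine lt_of_not_ge fun hle => ?_
  · have hneg := hle.lt_of_ne (hθ s hs).2
    obtain ⟨hz, hpos⟩ := key _ hneg
    obtain ⟨u, w, h, hu, hw⟩ := exists_isHomSol hr hI hc hα hβ hθ hs (-(r * jump α s)) 1
    have hul := h.leftLim_eq hJ hαJ hsJ
    have hur := h.rightLim_eq hJ hαJ hsJ
    have hwr := h.swap.rightLim_eq hJ hβJ hsJ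
    rw [hu, hw] at hul hur hwr
    have hur0 : rightLim u s = 0 := by rw [hur]; ring
    refine absurd_of u w (-1) h ?_ (by rw [hur0, mul_zero])
      (h.eventually_leftLim_pos hJ hmJ hαJ hsJ (Or.inl ?_))
      (h.eventually_rightLim_pos hJ hmJ hαJ hsJ (Or.inr ⟨hur0, ?_⟩))
    · rw [hu]
      exact neg_ne_zero.2 (mul_ne_zero hz hpos.ne')
    · rw [hul]
      linarith
    · rw [theta] at hneg
      rw [hwr]
      linarith
  · have hneg := hle.lt_of_ne (hθ s hs).1
    obtain ⟨hz, hpos⟩ := key _ hneg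
    obtain ⟨u, w, h, hu, hw⟩ := exists_isHomSol hr hI hc hα hβ hθ hs ((1 - r) * jump α s) 1
    have hul := h.leftLim_eq hJ hαJ hsJ
    have hur := h.rightLim_eq hJ hαJ hsJ
    have hwl := h.swap.leftLim_eq hJ hβJ hsJ
    rw [hu, hw] at hul hur hwl
    have hul0 : leftLim u s = 0 := by rw [hul]; ring
    refine absurd_of u w 1 h ?_ (by rw [hul0, zero_mul])
      (h.eventually_leftLim_pos hJ hmJ hαJ hsJ (Or.inr ⟨hul0, ?_⟩))
      (h.eventually_rightLim_pos hJ hmJ hαJ hsJ (Or.inl ?_))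
    · rw [hu]
      exact mul_ne_zero hz hpos.ne'
    · rw [theta] at hneg
      rw [hwl]
      linarith
    · rw [hur]
      linarith

lemma zSet_eq_of_theta_pos (hI : IsOpen I) (hc : I.OrdConnected)
    (hm : StrictMonoOn α I) (hβ : LocallyBoundedVariationOn β I)
    (hθ : ∀ x ∈ I, 0 < theta α β r x ∧ 0 < theta α β (1 - r) x)
    (h : IsHomSol I r α β u w) (hu : ¬∀ x ∈ I, u x = 0) :
    ZSet u I = {s ∈ I | ChangesSignAt I u s} := by
  have hα := hm.monotoneOn.locallyBoundedVariationOn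
  ext s
  refine and_congr_right fun hs => ?_
  obtain ⟨c, d, hJ, hsJ, -⟩ := exists_Icc_subset_of_mem_of_mem hI hc hs hs
  refine ⟨fun hZ => ?_, fun hC =>
    hC.leftLim_mul_rightLim_nonpos (h.1.1.boundedVariationOn_Icc hJ) hsJ⟩
  have h0 : ¬(u s = 0 ∧ w s = 0) := fun h0 => hu fun x hx =>
    (h.eqOn hI hc hα hβ (fun y hy => ⟨(hθ y hy).2.ne', (hθ y hy).1.ne'⟩)
      (isHomSol_zero hI hc hα hβ) hs h0.1 h0.2).1 hx
  obtain ⟨e, hl, hr⟩ := h.exists_eventually_sign hJ (hm.mono hJ) (hα.boundedVariationOn_Icc hJ)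
    (hβ.boundedVariationOn_Icc hJ) hsJ h0 (hθ s hs).1 (hθ s hs).2 hZ
  exact changesSignAt_of_eventually hI hs hl hr

end Cases

/-- Corollary 4.10: for every nontrivial real-valued `r`-balanced solution
`u` of `-d(dy/dα) + y dβ = 0`, `Z_{(a,b)}(u)` consists precisely of the points where `u`
changes sign, if and only if `θ_r > 0` and `θ_{1-r} > 0` on `(a,b)`. -/
theorem statement10 (a b : EReal) (hab : a < b) (r : ℝ) (hr : r ∈ Icc (0 : ℝ) 1)
    (α β : ℝ → ℝ) (hα : StrictMonoOn α (EI a b))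
    (hβ : LocallyBoundedVariationOn β (EI a b))
    (hθ : ∀ x ∈ EI a b, theta α β (1 - r) x ≠ 0 ∧ theta α β r x ≠ 0) :
    (∀ u w : ℝ → ℝ, IsHomSol (EI a b) r α β u w → ¬(∀ x ∈ EI a b, u x = 0) →
        ZSet u (EI a b) = {s ∈ EI a b | ChangesSignAt (EI a b) u s}) ↔
      ∀ x ∈ EI a b, 0 < theta α β r x ∧ 0 < theta α β (1 - r) x := by
  refine ⟨fun H x hx => theta_pos_of_zSet_eq hr (isOpen_EI a b) (ordConnected_EI a b) hα hβ hθ H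
    hx, fun H u w h hu => zSet_eq_of_theta_pos (isOpen_EI a b) (ordConnected_EI a b) hα hβ H h hu⟩
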